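/- Let Φ = (f_i)_{i∈Λ} be a diagonal iterated function system on ℝ² with attractor K satisfying the rectangular strong separation condition, and let μ = Π_*μ̄ be a self-affine measure on K, where μ̄ is the Bernoulli measure on Λ^ℕ with weights (p_i); assume ∑_i p_i log λ_i < ∑_i p_i log ρ_i. Let π(u,v) = u, let μ = ∫ δ_x × μ_x dπ_*μ(x) be the disintegration of μ over π, and write μ_𝚓 = μ_{π(Π(𝚓))} for 𝚓 ∈ Λ^ℕ. Then there exists c > 0 such that for μ̄-almost every 𝚒 ∈ Λ^ℕ the following holds: writing (x_k, y_k) = Π(σ^k𝚒) and s_k = log₂ρ_{𝚒|k} − log₂λ_{𝚒|k}, and letting ζ_{𝚒,k} be the normalized restriction to [−1,1]² of the pushforward of (π_*μ)_{x_k, s_k} × μ_{σ^k𝚒} under (u,v) ↦ (2^c·u, 2^c·(v − y_k)), one has (1/n)·∑_{k=0}^{n−1} d_LP(μ_{Π(𝚒), −log₂λ_{𝚒|k} + c}, ζ_{𝚒,k}) → 0 as n → ∞. -/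

import Mathlib

noncomputable section DiagCore

open MeasureTheory Filter Set Metric Topology

/-- A diagonal iterated function system on `ℝ²`: `f_i(x) = diag(ρ_i, λ_i)x + a_i` with
`0 < ρ_i, λ_i < 1`. -/
structure DiagIFS (Λ : Type*) where
  rho : Λ → ℝ
  lam : Λ → ℝ
  tr : Λ → ℝ × ℝ
  h_rho_pos : ∀ i, 0 < rho i
  h_rho_lt : ∀ i, rho i < 1
  h_lam_pos : ∀ i, 0 < lam i
  h_lam_lt : ∀ i, lam i < 1

namespace DiagIFS

variable {Λ : Type*}

/-- The affine map `f_i`. -/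
def toMap (Φ : DiagIFS Λ) (i : Λ) (z : ℝ × ℝ) : ℝ × ℝ :=
  (Φ.rho i * z.1 + (Φ.tr i).1, Φ.lam i * z.2 + (Φ.tr i).2)

/-- The square `[−1,1]²`. -/
def unitSq : Set (ℝ × ℝ) := Icc (-1 : ℝ) 1 ×ˢ Icc (-1 : ℝ) 1

/-- `K` is the attractor of `Φ`. -/
def IsAttractor (Φ : DiagIFS Λ) (K : Set (ℝ × ℝ)) : Prop :=
  K.Nonempty ∧ IsCompact K ∧ K = ⋃ i, Φ.toMap i '' K

/-- The rectangular strong separation condition. -/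
def RSSC (Φ : DiagIFS Λ) : Prop :=
  (∀ i, Φ.toMap i '' unitSq ⊆ unitSq) ∧
  Pairwise fun i j => Disjoint (Φ.toMap i '' unitSq) (Φ.toMap j '' unitSq)

/-- `μ` is the self-affine measure with weights `p`:
`μ = ∑ᵢ pᵢ (f_i)_*μ`, all `pᵢ > 0`. -/
def IsSelfAffine (Φ : DiagIFS Λ) [Fintype Λ] (p : Λ → ℝ) (μ : Measure (ℝ × ℝ)) : Prop :=
  IsProbabilityMeasure μ ∧ (∀ i, 0 < p i) ∧ (∑ i, p i = 1) ∧
  μ = ∑ i : Λ, ENNReal.ofReal (p i) • μ.map (Φ.toMap i)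

/-- `ρ_ω` for a finite word `ω`. -/
def wordRho (Φ : DiagIFS Λ) (w : List Λ) : ℝ := (w.map Φ.rho).prod

/-- `λ_ω` for a finite word `ω`. -/
def wordLam (Φ : DiagIFS Λ) (w : List Λ) : ℝ := (w.map Φ.lam).prod

/-- `Φ` has independent eigenvalues: `0` is an accumulation point of
`{log λ_ω − log ρ_𝚓 : ω, 𝚓 ∈ Λ*}`. -/
def IndepEigen (Φ : DiagIFS Λ) : Prop :=
  ∀ ε > (0:ℝ), ∃ v w : List Λ, v ≠ [] ∧ w ≠ [] ∧
    Real.log (Φ.wordLam v) - Real.log (Φ.wordRho w) ≠ 0 ∧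
    |Real.log (Φ.wordLam v) - Real.log (Φ.wordRho w)| < ε

/-- `μ` has simple Lyapunov spectrum. -/
def SimpleLyapunov (Φ : DiagIFS Λ) [Fintype Λ] (p : Λ → ℝ) : Prop :=
  ∑ i, p i * Real.log (Φ.rho i) ≠ ∑ i, p i * Real.log (Φ.lam i)

end DiagIFS

/-- A Borel probability measure `η` on a metric space is exact dimensional with
dimension `s` if `log η(B(x,r)) / log r → s` as `r → 0`, for `η`-a.e. `x`. -/
def ExactDimensional {X : Type*} [MeasurableSpace X] [PseudoMetricSpace X]
    (η : Measure X) (s : ℝ) : Prop :=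
  ∀ᵐ x ∂η, Tendsto (fun r => Real.log (η (closedBall x r)).toReal / Real.log r)
    (𝓝[>] (0:ℝ)) (𝓝 s)

end DiagCore

noncomputable section

open MeasureTheory Filter Set Metric Topology DiagIFS

/-- `f_ω = f_{i₁} ∘ ⋯ ∘ f_{iₙ}` for a finite word `ω = i₁⋯iₙ`. -/
def wordComp {Λ X : Type*} (f : Λ → X → X) : List Λ → X → X
  | [] => id
  | i :: w => f i ∘ wordComp f w

/-- The prefix `ω|_n` of an infinite word as a list. -/
def prefixList {Λ : Type*} (ω : ℕ → Λ) (n : ℕ) : List Λ := List.ofFn fun k : Fin n => ω k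

/-- The cylinder set `[ω]`. -/
def cylinder {Λ : Type*} (w : List Λ) : Set (ℕ → Λ) := {ω | ∀ k : Fin w.length, ω k = w.get k}

/-- `proj` is the canonical projection of the diagonal IFS. -/
def DiagIFS.IsCanonicalProj {Λ : Type*} (Φ : DiagIFS Λ) (proj : (ℕ → Λ) → ℝ × ℝ) : Prop :=
  ∀ ω, Tendsto (fun n => wordComp Φ.toMap (prefixList ω n) 0) atTop (𝓝 (proj ω))

/-- `μbar` is the Bernoulli measure with weights `p`. -/
def IsBernoulli {Λ : Type*} [MeasurableSpace Λ] (μbar : Measure (ℕ → Λ)) (p : Λ → ℝ) : Prop :=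
  IsProbabilityMeasure μbar ∧ ∀ w : List Λ, μbar (cylinder w) = ENNReal.ofReal ((w.map p).prod)

/-- Base-2 magnification `η_{z,t}(A) = η(2^{−t}A + z)/η(B(z,2^{−t}))`. -/
def magnify2 {E : Type*} [NormedAddCommGroup E] [NormedSpace ℝ E] [MeasurableSpace E]
    [BorelSpace E] (η : Measure E) (z : E) (t : ℝ) : Measure E :=
  (η (closedBall z ((2:ℝ) ^ (-t))))⁻¹ •
    ((η.restrict (closedBall z ((2:ℝ) ^ (-t)))).map (fun y => (2:ℝ) ^ t • (y - z)))

/-- Normalized restriction. -/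
def renormTo {X : Type*} [MeasurableSpace X] (A : Set X) (m : Measure X) : Measure X :=
  (m A)⁻¹ • m.restrict A

/-- The left shift `σ^k`. -/
def shift {Λ : Type*} (k : ℕ) (ω : ℕ → Λ) : ℕ → Λ := fun m => ω (m + k)

section Preliminaries

open ProbabilityTheory

section Symbolic

variable {Λ : Type*}

lemma shift_zero (ω : ℕ → Λ) : shift 0 ω = ω := rfl

lemma shift_shift (j k : ℕ) (ω : ℕ → Λ) : shift j (shift k ω) = shift (j + k) ω := by
  funext m
  simp [shift, add_assoc]

lemma shift_iterate (k : ℕ) : (shift 1 : (ℕ → Λ) → ℕ → Λ)^[k] = shift k := by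
  induction k with
  | zero => rfl
  | succ k ih =>
    funext ω
    rw [Function.iterate_succ_apply', ih, shift_shift, add_comm]

lemma prefixList_succ (ω : ℕ → Λ) (n : ℕ) :
    prefixList ω (n + 1) = ω 0 :: prefixList (shift 1 ω) n := by
  simp [prefixList, List.ofFn_succ, shift]

lemma length_prefixList (ω : ℕ → Λ) (n : ℕ) : (prefixList ω n).length = n := by
  simp [prefixList]

lemma mem_cylinder_prefixList {ω ω' : ℕ → Λ} {n : ℕ} :
    ω' ∈ _root_.cylinder (prefixList ω n) ↔ ∀ k < n, ω' k = ω k := by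
  constructor
  · intro h k hk
    have := h ⟨k, by simpa [prefixList] using hk⟩
    simpa [prefixList] using this
  · intro h k
    have hk : (k : ℕ) < n := by simpa [prefixList] using k.2
    rw [h k hk, List.get_eq_getElem]
    simp [prefixList]

lemma mem_cylinder_append {v w : List Λ} {ω : ℕ → Λ} :
    ω ∈ _root_.cylinder (w ++ v) ↔ ω ∈ _root_.cylinder w ∧ shift w.length ω ∈ _root_.cylinder v := by
  constructor
  · intro h
    refine ⟨fun k => ?_, fun k => ?_⟩
    · have := h ⟨k, by simp; omega⟩
      simpa using this
    · have := h ⟨k + w.length, by simp; omega⟩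
      simpa [shift] using this
  · rintro ⟨h1, h2⟩ k
    by_cases hk : (k : ℕ) < w.length
    · simpa [List.getElem_append_left, hk] using h1 ⟨k, hk⟩
    · have hk' : (k : ℕ) - w.length < v.length := by
        have := k.2
        simp at this
        omega
      have := h2 ⟨k - w.length, hk'⟩
      simp only [shift] at this
      rw [Nat.sub_add_cancel (by omega)] at this
      simpa [List.getElem_append_right, not_lt.1 hk] using this

lemma cylinder_subset_of_mem {v w : List Λ} {ω : ℕ → Λ} (hv : ω ∈ _root_.cylinder v)
    (hw : ω ∈ _root_.cylinder w) (h : v.length ≤ w.length) :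
    _root_.cylinder w ⊆ _root_.cylinder v := by
  intro ω' hω' k
  rw [hω' ⟨k, by omega⟩, ← hw ⟨k, by omega⟩, ← hv k]

lemma isPiSystem_cylinder : IsPiSystem (range (_root_.cylinder : List Λ → Set (ℕ → Λ))) := by
  rintro _ ⟨v, rfl⟩ _ ⟨w, rfl⟩ ⟨ω, hv, hw⟩
  rcases le_total v.length w.length with h | h
  · exact ⟨w, (inter_eq_right.2 (cylinder_subset_of_mem hv hw h)).symm⟩
  · exact ⟨v, (inter_eq_left.2 (cylinder_subset_of_mem hw hv h)).symm⟩

variable [MeasurableSpace Λ]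

lemma measurable_shift (k : ℕ) : Measurable (shift k : (ℕ → Λ) → ℕ → Λ) :=
  measurable_pi_lambda _ fun m => measurable_pi_apply (m + k)

variable [MeasurableSingletonClass Λ]

lemma measurableSet_cylinder (w : List Λ) : MeasurableSet (_root_.cylinder w) := by
  have : _root_.cylinder w = ⋂ k : Fin w.length, (fun ω : ℕ → Λ => ω k) ⁻¹' {w.get k} := by
    ext ω
    simp [_root_.cylinder]
  rw [this]
  exact MeasurableSet.iInter fun k => measurable_pi_apply (k : ℕ) (measurableSet_singleton _)

lemma generateFrom_cylinder [Fintype Λ] :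
    (MeasurableSpace.pi : MeasurableSpace (ℕ → Λ)) =
      MeasurableSpace.generateFrom (range (_root_.cylinder : List Λ → Set (ℕ → Λ))) := by
  apply le_antisymm
  · refine iSup_le fun i => ?_
    rintro _ ⟨s, -, rfl⟩
    have : (fun ω : ℕ → Λ => ω i) ⁻¹' s =
        ⋃ w ∈ {w : List Λ | _root_.cylinder w ⊆ (fun ω : ℕ → Λ => ω i) ⁻¹' s},
          _root_.cylinder w := by
      ext ω
      simp only [mem_preimage, mem_iUnion, mem_ofPred_eq, exists_prop]
      refine ⟨fun h => ⟨prefixList ω (i + 1), fun ω' hω' => ?_,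
        mem_cylinder_prefixList.2 fun _ _ => rfl⟩, fun ⟨w, hw, hω⟩ => hw hω⟩
      rw [mem_preimage, mem_cylinder_prefixList.1 hω' i (Nat.lt_succ_self i)]
      exact h
    rw [this]
    exact MeasurableSet.biUnion (Set.to_countable _) fun w _ =>
      MeasurableSpace.measurableSet_generateFrom ⟨w, rfl⟩
  · apply MeasurableSpace.generateFrom_le
    rintro _ ⟨w, rfl⟩
    exact measurableSet_cylinder w

lemma measure_ext_cylinder [Fintype Λ] {P Q : Measure (ℕ → Λ)} [IsFiniteMeasure P]
    (h : ∀ w, P (_root_.cylinder w) = Q (_root_.cylinder w)) : P = Q := by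
  refine ext_of_generate_finite _ generateFrom_cylinder isPiSystem_cylinder ?_ ?_
  · rintro _ ⟨w, rfl⟩
    exact h w
  · have : _root_.cylinder ([] : List Λ) = univ := by
      ext ω
      simp [_root_.cylinder]
    rw [← this]
    exact h []

variable [Fintype Λ] {P : Measure (ℕ → Λ)} {p : Λ → ℝ}

lemma IsBernoulli.cylinder_inter_shift (hP : IsBernoulli P p) (hp : ∀ i, 0 < p i) (w : List Λ)
    {E : Set (ℕ → Λ)} (hE : MeasurableSet E) :
    P (_root_.cylinder w ∩ shift w.length ⁻¹' E) = ENNReal.ofReal (w.map p).prod * P E := by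
  have := hP.1
  have key : (P.restrict (_root_.cylinder w)).map (shift w.length) =
      ENNReal.ofReal (w.map p).prod • P := by
    have : IsFiniteMeasure ((P.restrict (_root_.cylinder w)).map (shift w.length)) :=
      Measure.isFiniteMeasure_map _ _
    refine measure_ext_cylinder fun v => ?_
    rw [Measure.map_apply (measurable_shift _) (measurableSet_cylinder v),
      Measure.restrict_apply (measurable_shift _ (measurableSet_cylinder v)), inter_comm]
    have : _root_.cylinder w ∩ shift w.length ⁻¹' _root_.cylinder v = _root_.cylinder (w ++ v) := by
      ext ω
      exact mem_cylinder_append.symm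
    rw [this, hP.2, Measure.smul_apply, hP.2, smul_eq_mul, List.map_append, List.prod_append,
      ENNReal.ofReal_mul]
    exact List.prod_nonneg (by simp; exact fun a _ => (hp a).le)
  have h2 := congrArg (fun m => m E) key
  simp only [Measure.smul_apply, smul_eq_mul] at h2
  rw [← h2, Measure.map_apply (measurable_shift _) hE,
    Measure.restrict_apply (measurable_shift _ hE), inter_comm]

lemma IsBernoulli.measure_eq_sum (hP : IsBernoulli P p) (hp : ∀ i, 0 < p i) (s : Set Λ)
    [DecidablePred (· ∈ s)] {E : Set (ℕ → Λ)} (hE : MeasurableSet E) :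
    P ((fun ω => ω 0) ⁻¹' s ∩ shift 1 ⁻¹' E) =
      (∑ i with i ∈ s, ENNReal.ofReal (p i)) * P E := by
  have : (fun ω : ℕ → Λ => ω 0) ⁻¹' s ∩ shift 1 ⁻¹' E =
      ⋃ i ∈ (Finset.univ.filter (· ∈ s)), (_root_.cylinder [i] ∩ shift 1 ⁻¹' E) := by
    ext ω
    simp [_root_.cylinder]
  rw [this, measure_biUnion_finset, Finset.sum_mul]
  · refine Finset.sum_congr rfl fun i _ => ?_
    simpa using hP.cylinder_inter_shift hp [i] hE
  · intro i _ j _ hij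
    rw [Function.onFun, Set.disjoint_left]
    rintro ω ⟨h1, -⟩ ⟨h2, -⟩
    exact hij ((h1 ⟨0, by simp⟩).symm.trans (h2 ⟨0, by simp⟩))
  · exact fun i _ => (measurableSet_cylinder _).inter (measurable_shift 1 hE)

lemma IsBernoulli.measurePreserving_shift (hP : IsBernoulli P p) (hp : ∀ i, 0 < p i)
    (hp1 : ∑ i, p i = 1) (k : ℕ) : MeasurePreserving (shift k) P P := by
  have h1 : MeasurePreserving (shift 1) P P := by
    refine ⟨measurable_shift 1, ?_⟩
    ext E hE
    rw [Measure.map_apply (measurable_shift 1) hE]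
    classical
    have := hP.measure_eq_sum hp univ hE
    simp only [preimage_univ, univ_inter, mem_univ, Finset.filter_true] at this
    rw [this, ← ENNReal.ofReal_sum_of_nonneg fun i _ => (hp i).le, hp1]
    simp
  rw [← shift_iterate]
  exact h1.iterate k

lemma IsBernoulli.indepFun_eval (hP : IsBernoulli P p) (hp : ∀ i, 0 < p i)
    (hp1 : ∑ i, p i = 1) {i j : ℕ} (hij : i < j) :
    IndepFun (fun ω => ω i) (fun ω => ω j) P := by
  have := hP.1
  rw [indepFun_iff_measure_inter_preimage_eq_mul]
  intro s t hs ht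
  classical
  obtain ⟨d, rfl⟩ : ∃ d, j = d + 1 + i := ⟨j - i - 1, by omega⟩
  have hi := hP.measurePreserving_shift hp hp1 i
  have e0 : ∀ m (u : Set Λ), (fun ω : ℕ → Λ => ω (m + i)) ⁻¹' u =
      shift i ⁻¹' ((fun ω : ℕ → Λ => ω m) ⁻¹' u) := fun m u => rfl
  have m0 : ∀ m {u : Set Λ}, MeasurableSet u → MeasurableSet ((fun ω : ℕ → Λ => ω m) ⁻¹' u) :=
    fun m u hu => measurable_pi_apply m hu
  have e1 : (fun ω : ℕ → Λ => ω (d + 1)) ⁻¹' t =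
      shift 1 ⁻¹' ((fun ω : ℕ → Λ => ω d) ⁻¹' t) := rfl
  have hs0 := e0 0 s
  rw [zero_add] at hs0
  have h1 := hP.measure_eq_sum hp s (m0 d ht)
  have h2 := hP.measure_eq_sum hp s MeasurableSet.univ
  simp only [preimage_univ, inter_univ, measure_univ, mul_one] at h2
  rw [hs0, e0, ← preimage_inter, hi.measure_preimage ((m0 0 hs).inter (m0 _ ht)).nullMeasurableSet,
    hi.measure_preimage (m0 0 hs).nullMeasurableSet, hi.measure_preimage (m0 _ ht).nullMeasurableSet,
    e1, h1, (hP.measurePreserving_shift hp hp1 1).measure_preimage (m0 d ht).nullMeasurableSet, h2]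

lemma IsBernoulli.strong_law (hP : IsBernoulli P p) (hp : ∀ i, 0 < p i)
    (hp1 : ∑ i, p i = 1) (g : Λ → ℝ) :
    ∀ᵐ ω ∂P, Tendsto (fun n : ℕ => (∑ k ∈ Finset.range n, g (ω k)) / n) atTop
      (𝓝 (∑ i, p i * g i)) := by
  have := hP.1
  have hg : Measurable g := measurable_of_finite g
  have hX : ∀ k : ℕ, Measurable fun ω : ℕ → Λ => g (ω k) :=
    fun k => hg.comp (measurable_pi_apply k)
  have h := strong_law_ae_real (μ := P) (fun k ω => g (ω k)) ?_ ?_ ?_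
  · have hint : ∫ ω, g (ω 0) ∂P = ∑ i, p i * g i := by
      have : ∫ ω, g (ω 0) ∂P = ∫ a, g a ∂(P.map fun ω => ω 0) :=
        (integral_map (measurable_pi_apply 0).aemeasurable hg.aestronglyMeasurable).symm
      rw [this, integral_fintype]
      · refine Finset.sum_congr rfl fun i _ => ?_
        rw [Measure.real, Measure.map_apply (measurable_pi_apply 0) (measurableSet_singleton i)]
        have : (fun ω : ℕ → Λ => ω 0) ⁻¹' {i} = _root_.cylinder [i] := by
          ext ω
          simp [_root_.cylinder]
        rw [this, hP.2, smul_eq_mul]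
        simp [(hp i).le]
      · have : IsFiniteMeasure (P.map fun ω => ω 0) := Measure.isFiniteMeasure_map _ _
        exact Integrable.of_finite
    rw [hint] at h
    exact h
  · refine Integrable.of_bound (hX 0).aestronglyMeasurable (∑ i, |g i|) (ae_of_all _ fun ω => ?_)
    exact Finset.single_le_sum (f := fun i => |g i|) (fun i _ => abs_nonneg _) (Finset.mem_univ _)
  · intro i j hij
    rcases lt_or_gt_of_ne hij with h | h
    · exact (hP.indepFun_eval hp hp1 h).comp hg hg
    · exact ((hP.indepFun_eval hp hp1 h).comp hg hg).symm
  · intro i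
    have hi := hP.measurePreserving_shift hp hp1 i
    refine ⟨(hX i).aemeasurable, (hX 0).aemeasurable, ?_⟩
    have : (fun ω : ℕ → Λ => g (ω i)) = (fun ω => g (ω 0)) ∘ shift i := by
      funext ω
      simp [shift]
    rw [this, ← Measure.map_map (hX 0) (measurable_shift i), hi.map_eq]

end Symbolic

section Words

variable {Λ : Type*} (Φ : DiagIFS Λ)

lemma DiagIFS.wordRho_pos (w : List Λ) : 0 < Φ.wordRho w :=
  List.prod_pos (by simp; exact fun a _ => Φ.h_rho_pos a)

lemma DiagIFS.wordLam_pos (w : List Λ) : 0 < Φ.wordLam w :=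
  List.prod_pos (by simp; exact fun a _ => Φ.h_lam_pos a)

lemma DiagIFS.wordRho_prefixList (ω : ℕ → Λ) (n : ℕ) :
    Φ.wordRho (prefixList ω n) = ∏ k ∈ Finset.range n, Φ.rho (ω k) := by
  simp [wordRho, prefixList, List.map_ofFn, List.prod_ofFn, Finset.prod_range]

lemma DiagIFS.wordLam_prefixList (ω : ℕ → Λ) (n : ℕ) :
    Φ.wordLam (prefixList ω n) = ∏ k ∈ Finset.range n, Φ.lam (ω k) := by
  simp [wordLam, prefixList, List.map_ofFn, List.prod_ofFn, Finset.prod_range]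

/-- The logarithmic eccentricity `log₂ ρ_w − log₂ λ_w` of the rectangle coded by `w`. -/
def DiagIFS.ecc (w : List Λ) : ℝ := Real.logb 2 (Φ.wordRho w) - Real.logb 2 (Φ.wordLam w)

lemma DiagIFS.tendsto_ecc [Fintype Λ] [MeasurableSpace Λ] [MeasurableSingletonClass Λ]
    {P : Measure (ℕ → Λ)} {p : Λ → ℝ} (hP : IsBernoulli P p) (hp : ∀ i, 0 < p i)
    (hp1 : ∑ i, p i = 1)
    (hLyap : ∑ i, p i * Real.log (Φ.lam i) < ∑ i, p i * Real.log (Φ.rho i)) :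
    ∀ᵐ ω ∂P, Tendsto (fun n => Φ.ecc (prefixList ω n)) atTop atTop := by
  filter_upwards [hP.strong_law hp hp1
    fun i => Real.log (Φ.rho i) - Real.log (Φ.lam i)] with ω h
  have hpos : 0 < ∑ i, p i * (Real.log (Φ.rho i) - Real.log (Φ.lam i)) := by
    simp only [mul_sub, Finset.sum_sub_distrib]
    linarith
  have h2 := (h.pos_mul_atTop hpos tendsto_natCast_atTop_atTop).atTop_div_const
    (Real.log_pos one_lt_two)
  refine h2.congr' ?_
  filter_upwards [eventually_gt_atTop 0] with n hn
  have hn' : (n : ℝ) ≠ 0 := by positivity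
  rw [div_mul_cancel₀ _ hn', ecc, wordRho_prefixList, wordLam_prefixList, Real.logb, Real.logb,
    Real.log_prod fun i _ => (Φ.h_rho_pos _).ne', Real.log_prod fun i _ => (Φ.h_lam_pos _).ne',
    Finset.sum_sub_distrib, sub_div]

end Words

section MaximalErgodic

variable {Ω : Type*}

/-- The maximum of the Birkhoff sums of `g` of length at most `n`. -/
def maxBirkhoffSum (T : Ω → Ω) (g : Ω → ℝ) : ℕ → Ω → ℝ
  | 0 => fun _ => 0
  | n + 1 => fun ω => max 0 (g ω + maxBirkhoffSum T g n (T ω))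

lemma maxBirkhoffSum_nonneg (T : Ω → Ω) (g : Ω → ℝ) (n : ℕ) (ω : Ω) :
    0 ≤ maxBirkhoffSum T g n ω := by
  cases n with
  | zero => exact le_rfl
  | succ n => exact le_max_left _ _

lemma maxBirkhoffSum_le_succ (T : Ω → Ω) (g : Ω → ℝ) (n : ℕ) (ω : Ω) :
    maxBirkhoffSum T g n ω ≤ maxBirkhoffSum T g (n + 1) ω := by
  induction n generalizing ω with
  | zero => exact maxBirkhoffSum_nonneg T g 1 ω
  | succ n ih =>
    simp only [maxBirkhoffSum] at ih ⊢
    exact max_le_max le_rfl (by linarith [ih (T ω)])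

lemma maxBirkhoffSum_mono (T : Ω → Ω) (g : Ω → ℝ) (ω : Ω) :
    Monotone fun n => maxBirkhoffSum T g n ω :=
  monotone_nat_of_le_succ fun n => maxBirkhoffSum_le_succ T g n ω

lemma birkhoffSum_le_maxBirkhoffSum (T : Ω → Ω) (g : Ω → ℝ) (n : ℕ) (ω : Ω) :
    ∑ k ∈ Finset.range n, g (T^[k] ω) ≤ maxBirkhoffSum T g n ω := by
  induction n generalizing ω with
  | zero => simp [maxBirkhoffSum]
  | succ n ih =>
    rw [Finset.sum_range_succ']
    refine le_trans ?_ (le_max_right _ _)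
    have := ih (T ω)
    simp only [Function.iterate_succ_apply, Function.iterate_zero, id_eq]
    linarith

variable [MeasurableSpace Ω] {P : Measure Ω} {T : Ω → Ω} {g : Ω → ℝ}

lemma measurable_maxBirkhoffSum (hT : Measurable T) (hg : Measurable g) (n : ℕ) :
    Measurable (maxBirkhoffSum T g n) := by
  induction n with
  | zero => exact measurable_const
  | succ n ih => exact measurable_const.max (hg.add (ih.comp hT))

lemma integrable_maxBirkhoffSum (hT : MeasurePreserving T P P) (hg : Integrable g P) (n : ℕ) :
    Integrable (maxBirkhoffSum T g n) P := by
  induction n with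
  | zero => exact integrable_zero _ _ _
  | succ n ih =>
    exact (integrable_zero _ _ _).sup (hg.add (hT.integrable_comp_of_integrable ih))

lemma setIntegral_maxBirkhoffSum_nonneg (hT : MeasurePreserving T P P) (hg : Integrable g P)
    (hgm : Measurable g) (n : ℕ) :
    0 ≤ ∫ ω in {ω | 0 < maxBirkhoffSum T g (n + 1) ω}, g ω ∂P := by
  set M := maxBirkhoffSum T g
  set E := {ω | 0 < M (n + 1) ω}
  have hE : MeasurableSet E :=
    measurableSet_lt measurable_const (measurable_maxBirkhoffSum hT.measurable hgm (n + 1))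
  have hi := integrable_maxBirkhoffSum hT hg
  have hc : Integrable (fun ω => M n (T ω)) P := hT.integrable_comp_of_integrable (hi n)
  have h1 : ∫ ω in E, M (n + 1) ω ∂P ≤ ∫ ω in E, (g ω + M n (T ω)) ∂P := by
    refine setIntegral_mono_on (hi _).integrableOn (hg.add hc).integrableOn hE fun ω hω => ?_
    have hω' : 0 < max 0 (g ω + M n (T ω)) := hω
    rcases lt_max_iff.1 hω' with h | h
    · exact absurd h (lt_irrefl _)
    · exact (max_eq_right h.le).le
  rw [integral_add hg.integrableOn hc.integrableOn] at h1
  have h2 : ∫ ω in E, M (n + 1) ω ∂P = ∫ ω, M (n + 1) ω ∂P := by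
    refine setIntegral_eq_integral_of_forall_compl_eq_zero fun ω hω => ?_
    exact le_antisymm (not_lt.1 hω) (maxBirkhoffSum_nonneg T g _ ω)
  have h3 : ∫ ω in E, M n (T ω) ∂P ≤ ∫ ω, M n (T ω) ∂P :=
    setIntegral_le_integral hc (ae_of_all _ fun ω => maxBirkhoffSum_nonneg T g n _)
  have h4 : ∫ ω, M n (T ω) ∂P = ∫ ω, M n ω ∂P := by
    conv_rhs => rw [← hT.map_eq]
    refine (integral_map hT.aemeasurable ?_).symm
    rw [hT.map_eq]
    exact (hi n).aestronglyMeasurable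
  have h5 : ∫ ω, M n ω ∂P ≤ ∫ ω, M (n + 1) ω ∂P :=
    integral_mono (hi n) (hi _) fun ω => maxBirkhoffSum_le_succ T g n ω
  linarith

/-- The maximal ergodic inequality for functions with values in `[0, 1]`. -/
lemma maximal_ergodic [IsProbabilityMeasure P] (hT : MeasurePreserving T P P) {f : Ω → ENNReal}
    (hf : Measurable f) (hf1 : ∀ ω, f ω ≤ 1) {a : ℝ} (ha : 0 < a) :
    ENNReal.ofReal a * P {ω | ∃ n : ℕ, ENNReal.ofReal a * n < ∑ k ∈ Finset.range n, f (T^[k] ω)} ≤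
      ∫⁻ ω, f ω ∂P := by
  have hft : ∀ ω, f ω ≠ ⊤ := fun ω => ne_top_of_le_ne_top ENNReal.one_ne_top (hf1 ω)
  set g : Ω → ℝ := fun ω => (f ω).toReal - a
  have hfi : Integrable (fun ω => (f ω).toReal) P := by
    refine Integrable.of_bound hf.ennreal_toReal.aestronglyMeasurable 1 (ae_of_all _ fun ω => ?_)
    rw [Real.norm_of_nonneg ENNReal.toReal_nonneg]
    exact ENNReal.toReal_le_of_le_ofReal zero_le_one (by simpa using hf1 ω)
  have hg : Integrable g P := hfi.sub (integrable_const a)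
  have hgm : Measurable g := hf.ennreal_toReal.sub measurable_const
  set E : ℕ → Set Ω := fun n => {ω | 0 < maxBirkhoffSum T g (n + 1) ω}
  have hE : ∀ n, MeasurableSet (E n) := fun n =>
    measurableSet_lt measurable_const (measurable_maxBirkhoffSum hT.measurable hgm (n + 1))
  have hmono : Monotone E := fun m n hmn ω (hω : 0 < _) =>
    hω.trans_le (maxBirkhoffSum_mono T g ω (by omega))
  have hsub : {ω | ∃ n : ℕ, ENNReal.ofReal a * n < ∑ k ∈ Finset.range n, f (T^[k] ω)} ⊆
      ⋃ n, E n := by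
    rintro ω ⟨n, hn⟩
    refine mem_iUnion.2 ⟨n, ?_⟩
    have h1 := birkhoffSum_le_maxBirkhoffSum T g n ω
    have h2 := maxBirkhoffSum_le_succ T g n ω
    have h3 : (ENNReal.ofReal a * n).toReal < (∑ k ∈ Finset.range n, f (T^[k] ω)).toReal :=
      ENNReal.toReal_strict_mono (ENNReal.sum_ne_top.2 fun k _ => hft _) hn
    rw [ENNReal.toReal_sum fun k _ => hft _, ENNReal.toReal_mul, ENNReal.toReal_ofReal ha.le,
      ENNReal.toReal_natCast] at h3
    simp only [g, Finset.sum_sub_distrib, Finset.sum_const, Finset.card_range, nsmul_eq_mul] at h1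
    show 0 < maxBirkhoffSum T g (n + 1) ω
    linarith
  have hn : ∀ n, ENNReal.ofReal a * P (E n) ≤ ∫⁻ ω, f ω ∂P := by
    intro n
    have h := setIntegral_maxBirkhoffSum_nonneg hT hg hgm n
    rw [integral_sub hfi.integrableOn (integrable_const a).integrableOn] at h
    simp only [setIntegral_const, smul_eq_mul] at h
    have h2 : ∫ ω in E n, (f ω).toReal ∂P ≤ ∫ ω, (f ω).toReal ∂P :=
      setIntegral_le_integral hfi (ae_of_all _ fun ω => ENNReal.toReal_nonneg)
    have h3 : ∫ ω, (f ω).toReal ∂P = (∫⁻ ω, f ω ∂P).toReal :=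
      integral_toReal hf.aemeasurable (ae_of_all _ fun ω => (hft ω).lt_top)
    have h4 : ∫⁻ ω, f ω ∂P ≠ ⊤ := by
      refine ne_top_of_le_ne_top ENNReal.one_ne_top ((lintegral_mono hf1).trans ?_)
      simp
    rw [← ENNReal.ofReal_toReal (measure_ne_top P (E n)), ← ENNReal.ofReal_mul ha.le,
      ENNReal.ofReal_le_iff_le_toReal h4, ← h3]
    have : (P (E n)).toReal * a ≤ ∫ ω in E n, (f ω).toReal ∂P := by
      simpa [Measure.real] using h
    linarith
  calc _ ≤ ENNReal.ofReal a * P (⋃ n, E n) := by gcongr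
    _ = ⨆ n, ENNReal.ofReal a * P (E n) := by
      rw [hmono.measure_iUnion, ENNReal.mul_iSup]
    _ ≤ _ := iSup_le hn

/-- If `H N → 0` almost surely, the Birkhoff averages of `H N` are uniformly small for large `N`. -/
lemma ae_exists_birkhoffSum_le [IsProbabilityMeasure P] (hT : MeasurePreserving T P P)
    {H : ℕ → Ω → ENNReal} (hH : ∀ N, Measurable (H N)) (hH1 : ∀ N ω, H N ω ≤ 1)
    (hlim : ∀ᵐ ω ∂P, Tendsto (fun N => H N ω) atTop (𝓝 0)) {a : ℝ} (ha : 0 < a) :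
    ∀ᵐ ω ∂P, ∃ N, ∀ n : ℕ, ∑ k ∈ Finset.range n, H N (T^[k] ω) ≤ ENNReal.ofReal a * n := by
  have h0 : Tendsto (fun N => ∫⁻ ω, H N ω ∂P) atTop (𝓝 0) := by
    have := tendsto_lintegral_of_dominated_convergence (μ := P) (F := H) (f := fun _ => 0)
      (fun _ => 1) hH (fun N => ae_of_all _ (hH1 N)) (by simp) hlim
    simpa using this
  have hle : ∀ N, ENNReal.ofReal a * P {ω | ¬ ∃ N, ∀ n : ℕ,
      ∑ k ∈ Finset.range n, H N (T^[k] ω) ≤ ENNReal.ofReal a * n} ≤ ∫⁻ ω, H N ω ∂P := by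
    intro N
    refine le_trans ?_ (maximal_ergodic hT (hH N) (hH1 N) ha)
    gcongr with ω
    intro hω
    simpa using not_exists.1 hω N
  have := ge_of_tendsto' h0 hle
  rw [ae_iff]
  simpa [ha.not_ge] using this

end MaximalErgodic

section Geometry

variable {Λ : Type*} {Φ : DiagIFS Λ} {proj : (ℕ → Λ) → ℝ × ℝ}

lemma DiagIFS.continuous_toMap (i : Λ) : Continuous (Φ.toMap i) := by
  unfold toMap
  fun_prop

lemma DiagIFS.continuous_wordComp (w : List Λ) : Continuous (wordComp Φ.toMap w) := by
  induction w with
  | nil => exact continuous_id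
  | cons i w ih => exact (Φ.continuous_toMap i).comp ih

lemma DiagIFS.wordComp_sub (w : List Λ) (a b : ℝ × ℝ) :
    wordComp Φ.toMap w a - wordComp Φ.toMap w b =
      (Φ.wordRho w * (a.1 - b.1), Φ.wordLam w * (a.2 - b.2)) := by
  induction w with
  | nil => ext <;> simp [wordComp, wordRho, wordLam]
  | cons i w ih =>
    have h1 := congrArg Prod.fst ih
    have h2 := congrArg Prod.snd ih
    simp only [Prod.fst_sub, Prod.snd_sub] at h1 h2
    ext
    · simp only [wordComp, toMap, Function.comp, Prod.fst_sub, wordRho, List.map_cons,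
        List.prod_cons] at h1 ⊢
      linear_combination Φ.rho i * h1
    · simp only [wordComp, toMap, Function.comp, Prod.snd_sub, wordLam, List.map_cons,
        List.prod_cons] at h2 ⊢
      linear_combination Φ.lam i * h2

namespace DiagIFS.IsCanonicalProj

lemma eq_toMap (hproj : Φ.IsCanonicalProj proj) (ω : ℕ → Λ) :
    proj ω = Φ.toMap (ω 0) (proj (shift 1 ω)) := by
  refine tendsto_nhds_unique ((hproj ω).comp (tendsto_add_atTop_nat 1)) ?_
  have := ((Φ.continuous_toMap (ω 0)).tendsto _).comp (hproj (shift 1 ω))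
  refine this.congr fun n => ?_
  simp [prefixList_succ, wordComp]

lemma eq_wordComp (hproj : Φ.IsCanonicalProj proj) (ω : ℕ → Λ) (k : ℕ) :
    proj ω = wordComp Φ.toMap (prefixList ω k) (proj (shift k ω)) := by
  induction k generalizing ω with
  | zero => simp [prefixList, wordComp, shift_zero]
  | succ k ih =>
    rw [hproj.eq_toMap, ih (shift 1 ω), shift_shift, prefixList_succ]
    rfl

lemma mem_unitSq (hproj : Φ.IsCanonicalProj proj) (hsep : Φ.RSSC) (ω : ℕ → Λ) :
    proj ω ∈ unitSq := by
  have hc : IsClosed (unitSq : Set (ℝ × ℝ)) := isClosed_Icc.prod isClosed_Icc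
  have hw : ∀ w : List Λ, wordComp Φ.toMap w 0 ∈ unitSq := by
    intro w
    induction w with
    | nil => simp [wordComp, unitSq, Prod.le_def]
    | cons i w ih => exact hsep.1 i (mem_image_of_mem _ ih)
  exact hc.mem_of_tendsto (hproj ω) (Eventually.of_forall fun n => hw _)

lemma measurable [Countable Λ] [MeasurableSpace Λ] [MeasurableSingletonClass Λ]
    (hproj : Φ.IsCanonicalProj proj) : Measurable proj := by
  refine measurable_of_tendsto_metrizable (f := fun n ω => wordComp Φ.toMap (prefixList ω n) 0)
    (fun n => ?_) (tendsto_pi_nhds.2 hproj)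
  have h1 : Measurable fun v : Fin n → Λ => wordComp Φ.toMap (List.ofFn v) 0 :=
    measurable_of_countable _
  exact h1.comp (measurable_pi_lambda _ fun k => measurable_pi_apply (k : ℕ))

end DiagIFS.IsCanonicalProj

lemma DiagIFS.RSSC.exists_gap [Finite Λ] (hsep : Φ.RSSC) :
    ∃ δ : ℝ, 0 < δ ∧ ∀ i j, i ≠ j → ∀ a ∈ Φ.toMap i '' unitSq, ∀ b ∈ Φ.toMap j '' unitSq,
      δ ≤ |a.1 - b.1| ∨ δ ≤ |a.2 - b.2| := by
  have hc : IsCompact (unitSq : Set (ℝ × ℝ)) := isCompact_Icc.prod isCompact_Icc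
  have hk : ∀ i, IsCompact (Φ.toMap i '' unitSq) := fun i => hc.image (Φ.continuous_toMap i)
  have h : ∀ q : Λ × Λ, ∃ δ : ℝ, 0 < δ ∧ (q.1 ≠ q.2 → ∀ a ∈ Φ.toMap q.1 '' unitSq,
      ∀ b ∈ Φ.toMap q.2 '' unitSq, δ ≤ dist a b) := by
    intro q
    by_cases hq : q.1 = q.2
    · exact ⟨1, one_pos, fun h => absurd hq h⟩
    · obtain ⟨δ, hδ, hd⟩ := (hsep.2 hq).exists_thickenings (hk _) (hk _).isClosed
      refine ⟨δ, hδ, fun _ a ha b hb => not_lt.1 fun hlt => ?_⟩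
      exact Set.disjoint_left.1 hd (mem_thickening_iff.2 ⟨a, ha, by simpa using hδ⟩)
        (mem_thickening_iff.2 ⟨b, hb, hlt⟩)
  choose δ hδ hd using h
  cases nonempty_fintype Λ
  by_cases hne : Nonempty Λ
  · refine ⟨Finset.univ.inf' Finset.univ_nonempty δ, (Finset.lt_inf'_iff _).2 fun q _ => hδ q,
      fun i j hij a ha b hb => ?_⟩
    have h1 := (Finset.inf'_le δ (Finset.mem_univ (i, j))).trans (hd (i, j) hij a ha b hb)
    rwa [Prod.dist_eq, le_max_iff, Real.dist_eq, Real.dist_eq] at h1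
  · exact ⟨1, one_pos, fun i => (hne ⟨i⟩).elim⟩

lemma DiagIFS.wordRho_prefixList_antitone (ω : ℕ → Λ) :
    Antitone fun n => Φ.wordRho (prefixList ω n) := by
  refine antitone_nat_of_succ_le fun n => ?_
  have := Φ.wordRho_pos (prefixList ω n)
  simp only [wordRho_prefixList, Finset.prod_range_succ] at this ⊢
  exact mul_le_of_le_one_right this.le (Φ.h_rho_lt _).le

lemma DiagIFS.wordLam_prefixList_antitone (ω : ℕ → Λ) :
    Antitone fun n => Φ.wordLam (prefixList ω n) := by
  refine antitone_nat_of_succ_le fun n => ?_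
  have := Φ.wordLam_pos (prefixList ω n)
  simp only [wordLam_prefixList, Finset.prod_range_succ] at this ⊢
  exact mul_le_of_le_one_right this.le (Φ.h_lam_lt _).le

lemma DiagIFS.rpow_ecc (w : List Λ) : (2 : ℝ) ^ Φ.ecc w = Φ.wordRho w / Φ.wordLam w := by
  rw [ecc, Real.rpow_sub two_pos, Real.rpow_logb two_pos (by norm_num) (Φ.wordRho_pos w),
    Real.rpow_logb two_pos (by norm_num) (Φ.wordLam_pos w)]

lemma DiagIFS.eventually_wordLam_le {ω : ℕ → Λ}
    (h : Tendsto (fun n => Φ.ecc (prefixList ω n)) atTop atTop) :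
    ∀ᶠ k in atTop, ∀ m ≤ k, Φ.wordLam (prefixList ω k) ≤ Φ.wordRho (prefixList ω m) := by
  have h2 : Tendsto (fun n => Φ.wordRho (prefixList ω n) / Φ.wordLam (prefixList ω n))
      atTop atTop := by
    simp_rw [← rpow_ecc]
    exact (tendsto_rpow_atTop_of_base_gt_one 2 one_lt_two).comp h
  obtain ⟨m₀, hm₀⟩ := eventually_atTop.1 (h2.eventually_ge_atTop 1)
  filter_upwards [h2.eventually_ge_atTop (Φ.wordRho (prefixList ω m₀))⁻¹] with k hk m hmk
  have hlam := Φ.wordLam_pos (prefixList ω k)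
  have hrho := Φ.wordRho_pos (prefixList ω m₀)
  rcases le_total m₀ m with hm | hm
  · refine (Φ.wordLam_prefixList_antitone ω hmk).trans ?_
    have := hm₀ m hm
    rwa [le_div_iff₀ (Φ.wordLam_pos _), one_mul] at this
  · refine le_trans ?_ (Φ.wordRho_prefixList_antitone ω hm)
    have h1 : Φ.wordRho (prefixList ω k) ≤ 1 := by
      have := Φ.wordRho_prefixList_antitone ω (Nat.zero_le k)
      simpa [prefixList, wordRho] using this
    rw [le_div_iff₀ hlam, inv_mul_le_iff₀ hrho] at hk
    nlinarith

lemma DiagIFS.IsCanonicalProj.eventually_mem_cylinder (hproj : Φ.IsCanonicalProj proj)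
    (hsep : Φ.RSSC) {δ r : ℝ} (hδ : ∀ i j, i ≠ j → ∀ a ∈ Φ.toMap i '' unitSq,
      ∀ b ∈ Φ.toMap j '' unitSq, δ ≤ |a.1 - b.1| ∨ δ ≤ |a.2 - b.2|) (hr : 0 < r) (hrδ : r < δ)
    {ω : ℕ → Λ} (h : Tendsto (fun n => Φ.ecc (prefixList ω n)) atTop atTop) :
    ∀ᶠ k in atTop, ∀ ω', proj ω' ∈ closedBall (proj ω) (Φ.wordLam (prefixList ω k) * r) →
      ω' ∈ _root_.cylinder (prefixList ω k) := by
  filter_upwards [Φ.eventually_wordLam_le h] with k hk ω' hω'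
  rw [mem_cylinder_prefixList]
  by_contra! hne
  classical
  obtain ⟨hmk, hm⟩ := Nat.find_spec hne
  have hmin : ∀ l < Nat.find hne, ω' l = ω l := fun l hl => by
    by_contra hcon
    exact Nat.find_min hne hl ⟨by omega, hcon⟩
  set m := Nat.find hne
  have hpre : prefixList ω' m = prefixList ω m := by
    simp only [prefixList, List.ofFn_inj]
    funext l
    exact hmin l l.2
  have e1 := hproj.eq_wordComp ω m
  have e2 := hproj.eq_wordComp ω' m
  rw [hpre] at e2
  have e3 := Φ.wordComp_sub (prefixList ω m) (proj (shift m ω')) (proj (shift m ω))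
  rw [← e1, ← e2] at e3
  have hmem : ∀ τ : ℕ → Λ, proj (shift m τ) ∈ Φ.toMap (τ m) '' unitSq := by
    intro τ
    rw [hproj.eq_toMap]
    simp only [shift, zero_add]
    exact mem_image_of_mem _ (hproj.mem_unitSq hsep _)
  have f1 := congrArg Prod.fst e3
  have f2 := congrArg Prod.snd e3
  simp only [Prod.fst_sub, Prod.snd_sub] at f1 f2
  rw [mem_closedBall, Prod.dist_eq, max_le_iff, Real.dist_eq, Real.dist_eq, f1, f2, abs_mul,
    abs_mul, abs_of_pos (Φ.wordRho_pos _), abs_of_pos (Φ.wordLam_pos _)] at hω'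
  have hlam := Φ.wordLam_pos (prefixList ω k)
  rcases hδ _ _ hm _ (hmem ω') _ (hmem ω) with hd | hd
  · have := mul_le_mul (hk m hmk.le) hd (hr.trans hrδ).le (Φ.wordRho_pos _).le
    nlinarith [hω'.1]
  · have := mul_le_mul (Φ.wordLam_prefixList_antitone ω hmk.le) hd (hr.trans hrδ).le
      (Φ.wordLam_pos _).le
    nlinarith [hω'.2]

end Geometry

section Zoom

/-- The rectangle centred at `z` with half-width `a` and half-height `b`. -/
def rectAt (z : ℝ × ℝ) (a b : ℝ) : Set (ℝ × ℝ) := closedBall z.1 a ×ˢ closedBall z.2 b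

/-- The diagonal affine map sending `z` to `0` with rates `a` and `b`. -/
def zoomMap (z : ℝ × ℝ) (a b : ℝ) (q : ℝ × ℝ) : ℝ × ℝ := (a * (q.1 - z.1), b * (q.2 - z.2))

/-- The normalized restriction of `m` to a rectangle of half-width `2^(-(s+c))` and half-height
`2^(-c)` centred at `z`, rescaled to `[-1,1]²`. -/
def zoomed (m : Measure (ℝ × ℝ)) (z : ℝ × ℝ) (s c : ℝ) : Measure (ℝ × ℝ) :=
  (m (rectAt z ((2 : ℝ) ^ (-(s + c))) ((2 : ℝ) ^ (-c))))⁻¹ •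
    ((m.restrict (rectAt z ((2 : ℝ) ^ (-(s + c))) ((2 : ℝ) ^ (-c)))).map
      (zoomMap z ((2 : ℝ) ^ (s + c)) ((2 : ℝ) ^ c)))

lemma measurableSet_rectAt (z : ℝ × ℝ) (a b : ℝ) : MeasurableSet (rectAt z a b) :=
  measurableSet_closedBall.prod measurableSet_closedBall

lemma measurable_zoomMap (z : ℝ × ℝ) (a b : ℝ) : Measurable (zoomMap z a b) := by
  unfold zoomMap
  fun_prop

lemma zoomed_apply (m : Measure (ℝ × ℝ)) (z : ℝ × ℝ) (s c : ℝ) {B : Set (ℝ × ℝ)}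
    (hB : MeasurableSet B) :
    zoomed m z s c B = (m (rectAt z ((2 : ℝ) ^ (-(s + c))) ((2 : ℝ) ^ (-c))))⁻¹ *
      m (zoomMap z ((2 : ℝ) ^ (s + c)) ((2 : ℝ) ^ c) ⁻¹' B ∩
        rectAt z ((2 : ℝ) ^ (-(s + c))) ((2 : ℝ) ^ (-c))) := by
  rw [zoomed, Measure.smul_apply, smul_eq_mul, Measure.map_apply (measurable_zoomMap _ _ _) hB,
    Measure.restrict_apply (measurable_zoomMap _ _ _ hB)]

lemma zoomed_univ_le (m : Measure (ℝ × ℝ)) (z : ℝ × ℝ) (s c : ℝ) : zoomed m z s c univ ≤ 1 := by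
  rw [zoomed_apply _ _ _ _ MeasurableSet.univ, preimage_univ, univ_inter]
  exact ENNReal.inv_mul_le_one _

variable {Λ : Type*} [Fintype Λ] [MeasurableSpace Λ] [MeasurableSingletonClass Λ]
  {Φ : DiagIFS Λ} {proj : (ℕ → Λ) → ℝ × ℝ} {P : Measure (ℕ → Λ)} {p : Λ → ℝ}

lemma DiagIFS.IsCanonicalProj.magnify2_eq_zoomed (hproj : Φ.IsCanonicalProj proj)
    (hP : IsBernoulli P p) (hp : ∀ i, 0 < p i) (ω : ℕ → Λ) (k : ℕ) (c : ℝ)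
    (h : ∀ ω', proj ω' ∈ closedBall (proj ω) (Φ.wordLam (prefixList ω k) * (2 : ℝ) ^ (-c)) →
      ω' ∈ _root_.cylinder (prefixList ω k)) :
    magnify2 (P.map proj) (proj ω) (-Real.logb 2 (Φ.wordLam (prefixList ω k)) + c) =
      zoomed (P.map proj) (proj (shift k ω)) (Φ.ecc (prefixList ω k)) c := by
  set w := prefixList ω k with hw
  set z := proj (shift k ω) with hz
  have hm := hproj.measurable
  have hlam := Φ.wordLam_pos w
  have hrho := Φ.wordRho_pos w
  have h2c : (0 : ℝ) < 2 ^ c := by positivity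
  have a1 : (2 : ℝ) ^ (-(-Real.logb 2 (Φ.wordLam w) + c)) = Φ.wordLam w * 2 ^ (-c) := by
    rw [neg_add, neg_neg, Real.rpow_add two_pos, Real.rpow_logb two_pos (by norm_num) hlam]
  have a2 : (2 : ℝ) ^ (-Real.logb 2 (Φ.wordLam w) + c) = (Φ.wordLam w)⁻¹ * 2 ^ c := by
    rw [Real.rpow_add two_pos, Real.rpow_neg two_pos.le,
      Real.rpow_logb two_pos (by norm_num) hlam]
  have a3 : (2 : ℝ) ^ (Φ.ecc w + c) = Φ.wordRho w / Φ.wordLam w * 2 ^ c := by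
    rw [Real.rpow_add two_pos, rpow_ecc]
  have a4 : (2 : ℝ) ^ (-(Φ.ecc w + c)) = Φ.wordLam w / Φ.wordRho w * 2 ^ (-c) := by
    rw [Real.rpow_neg two_pos.le, a3, Real.rpow_neg two_pos.le, mul_inv, inv_div]
  have hpω : proj ω = wordComp Φ.toMap w z := hproj.eq_wordComp ω k
  have hsub : ∀ q, wordComp Φ.toMap w q - proj ω =
      (Φ.wordRho w * (q.1 - z.1), Φ.wordLam w * (q.2 - z.2)) := fun q => by
    rw [hpω, Φ.wordComp_sub]
  have hball : wordComp Φ.toMap w ⁻¹' closedBall (proj ω) (Φ.wordLam w * 2 ^ (-c)) =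
      rectAt z (Φ.wordLam w / Φ.wordRho w * 2 ^ (-c)) (2 ^ (-c)) := by
    ext q
    rw [mem_preimage, mem_closedBall, dist_eq_norm, hsub, rectAt, mem_prod, mem_closedBall,
      mem_closedBall, Prod.norm_def, max_le_iff, Real.norm_eq_abs, Real.norm_eq_abs, abs_mul,
      abs_mul, abs_of_pos hlam, abs_of_pos hrho, Real.dist_eq, Real.dist_eq,
      mul_le_mul_iff_right₀ hlam]
    refine and_congr_left fun _ => ?_
    rw [div_mul_eq_mul_div, le_div_iff₀ hrho, mul_comm]
  have hzoom : ∀ q, ((Φ.wordLam w)⁻¹ * 2 ^ c) • (wordComp Φ.toMap w q - proj ω) =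
      zoomMap z (Φ.wordRho w / Φ.wordLam w * 2 ^ c) (2 ^ c) q := by
    intro q
    rw [hsub, zoomMap]
    ext
    · simp only [Prod.smul_fst, smul_eq_mul]
      ring
    · simp only [Prod.smul_snd, smul_eq_mul]
      field_simp
  have key : ∀ A, MeasurableSet A → A ⊆ closedBall (proj ω) (Φ.wordLam w * 2 ^ (-c)) →
      P.map proj A = ENNReal.ofReal (w.map p).prod * P.map proj (wordComp Φ.toMap w ⁻¹' A) := by
    intro A hA hAB
    have hwA := (Φ.continuous_wordComp w).measurable hA
    rw [Measure.map_apply hm hA, Measure.map_apply hm hwA,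
      ← hP.cylinder_inter_shift hp w (hm hwA), length_prefixList]
    congr 1
    ext τ
    constructor
    · intro hτ
      have hc := h τ (hAB hτ)
      refine ⟨hc, ?_⟩
      have : prefixList τ k = w := by
        simp only [hw, prefixList, List.ofFn_inj]
        funext l
        exact mem_cylinder_prefixList.1 hc l l.2
      rw [mem_preimage, mem_preimage, mem_preimage, ← this, ← hproj.eq_wordComp τ k]
      exact hτ
    · rintro ⟨hc, hτ⟩
      have : prefixList τ k = w := by
        simp only [hw, prefixList, List.ofFn_inj]
        funext l
        exact mem_cylinder_prefixList.1 hc l l.2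
      rw [mem_preimage, mem_preimage, mem_preimage, ← this, ← hproj.eq_wordComp τ k] at hτ
      exact hτ
  have hpw : ENNReal.ofReal (w.map p).prod ≠ 0 := by
    simp only [ne_eq, ENNReal.ofReal_eq_zero, not_le]
    exact List.prod_pos (by simp; exact fun a _ => hp a)
  ext B hB
  have hmz : Measurable fun y : ℝ × ℝ => ((Φ.wordLam w)⁻¹ * 2 ^ c) • (y - proj ω) := by fun_prop
  rw [zoomed_apply _ _ _ _ hB, magnify2, a1, a2, a3, a4, Measure.smul_apply, smul_eq_mul,
    Measure.map_apply hmz hB, Measure.restrict_apply (hmz hB),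
    key _ measurableSet_closedBall subset_rfl,
    key _ ((hmz hB).inter measurableSet_closedBall) inter_subset_right, preimage_inter, hball,
    ENNReal.mul_inv (Or.inl hpw) (Or.inl ENNReal.ofReal_ne_top), ← preimage_comp]
  have : (fun y : ℝ × ℝ => ((Φ.wordLam w)⁻¹ * 2 ^ c) • (y - proj ω)) ∘ wordComp Φ.toMap w =
      zoomMap z (Φ.wordRho w / Φ.wordLam w * 2 ^ c) (2 ^ c) := funext hzoom
  rw [this, mul_mul_mul_comm, ENNReal.inv_mul_cancel hpw ENNReal.ofReal_ne_top, one_mul]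

lemma renormTo_prod_eq_zoomed (ν η : Measure ℝ) [IsFiniteMeasure ν] [IsFiniteMeasure η]
    (z : ℝ × ℝ) (s : ℝ) {c : ℝ} (hc : 0 < c) (hν : ν (closedBall z.1 ((2 : ℝ) ^ (-s))) ≠ 0) :
    renormTo (closedBall (0 : ℝ × ℝ) 1) (((magnify2 ν z.1 s).prod η).map
      (fun q : ℝ × ℝ => ((2 : ℝ) ^ c * q.1, (2 : ℝ) ^ c * (q.2 - z.2)))) =
      zoomed (ν.prod η) z s c := by
  set I := closedBall z.1 ((2 : ℝ) ^ (-s))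
  have h2c : (0 : ℝ) < 2 ^ c := by positivity
  have h2s : (0 : ℝ) < 2 ^ (s + c) := by positivity
  have hh : Measurable fun y : ℝ => (2 : ℝ) ^ s • (y - z.1) := by fun_prop
  have hg : Measurable fun q : ℝ × ℝ => ((2 : ℝ) ^ c * q.1, (2 : ℝ) ^ c * (q.2 - z.2)) := by
    fun_prop
  have hm : ((magnify2 ν z.1 s).prod η).map
      (fun q : ℝ × ℝ => ((2 : ℝ) ^ c * q.1, (2 : ℝ) ^ c * (q.2 - z.2))) =
      (ν I)⁻¹ • ((ν.prod η).restrict (I ×ˢ univ)).map (zoomMap z (2 ^ (s + c)) (2 ^ c)) := by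
    rw [magnify2, Measure.prod_smul_left, Measure.map_smul]
    congr 1
    have : ((ν.restrict I).map fun y : ℝ => (2 : ℝ) ^ s • (y - z.1)).prod η =
        ((ν.restrict I).prod η).map (Prod.map (fun y : ℝ => (2 : ℝ) ^ s • (y - z.1)) id) := by
      rw [← Measure.map_prod_map _ _ hh measurable_id, Measure.map_id]
    rw [this, Measure.map_map hg (hh.prodMap measurable_id), ← Measure.prod_restrict,
      Measure.restrict_univ]
    congr 1
    funext q
    simp only [Function.comp, Prod.map, zoomMap, id, smul_eq_mul, Real.rpow_add two_pos]
    ext <;> (simp only [] <;> ring)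
  have hpre : zoomMap z (2 ^ (s + c)) (2 ^ c) ⁻¹' closedBall (0 : ℝ × ℝ) 1 =
      rectAt z ((2 : ℝ) ^ (-(s + c))) ((2 : ℝ) ^ (-c)) := by
    ext q
    rw [mem_preimage, mem_closedBall, dist_zero_right, zoomMap, rectAt, mem_prod, mem_closedBall,
      mem_closedBall, Prod.norm_def, max_le_iff, Real.norm_eq_abs, Real.norm_eq_abs, abs_mul,
      abs_mul, abs_of_pos h2c, abs_of_pos h2s, Real.dist_eq, Real.dist_eq,
      Real.rpow_neg two_pos.le, Real.rpow_neg two_pos.le]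
    rw [← one_div, ← one_div, le_div_iff₀' h2s, le_div_iff₀' h2c]
  have hsub : rectAt z ((2 : ℝ) ^ (-(s + c))) ((2 : ℝ) ^ (-c)) ⊆ I ×ˢ univ := by
    refine prod_mono (closedBall_subset_closedBall ?_) (subset_univ _)
    exact Real.rpow_le_rpow_of_exponent_le one_le_two (by linarith)
  have hz := measurable_zoomMap z (2 ^ (s + c)) (2 ^ c)
  have hI : (ν I)⁻¹ ≠ 0 := ENNReal.inv_ne_zero.2 (measure_ne_top ν I)
  have hI' : (ν I)⁻¹ ≠ ⊤ := ENNReal.inv_ne_top.2 hν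
  ext B hB
  rw [hm, renormTo, zoomed_apply _ _ _ _ hB, Measure.smul_apply, Measure.restrict_apply hB,
    Measure.smul_apply, Measure.smul_apply, Measure.map_apply hz measurableSet_closedBall,
    Measure.map_apply hz (hB.inter measurableSet_closedBall), preimage_inter, hpre,
    Measure.restrict_apply (measurableSet_rectAt _ _ _),
    Measure.restrict_apply ((hz hB).inter (measurableSet_rectAt _ _ _)), inter_assoc,
    inter_eq_left.2 hsub, smul_eq_mul, smul_eq_mul, smul_eq_mul, ENNReal.mul_inv (Or.inl hI)
    (Or.inl hI'), mul_mul_mul_comm, ENNReal.inv_mul_cancel hI hI', one_mul]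

end Zoom

section Grid

/-- The sets `(-∞, -r + 2rj/q)` for `j < q`, and `(-∞, r]` for `j ≥ q`. -/
def gridSet (r : ℝ) (q j : ℕ) : Set ℝ := if j < q then Iio (-r + 2 * r * j / q) else Iic r

/-- The threshold at which `gridSet r q j` ends. -/
def gridPt (r : ℝ) (q j : ℕ) : ℝ := if j < q then -r + 2 * r * j / q else r

variable {r : ℝ} {q : ℕ}

lemma gridSet_eq_of_lt {j : ℕ} (h : j < q) : gridSet r q j = Iio (-r + 2 * r * j / q) := if_pos h

lemma gridSet_eq_of_ge {j : ℕ} (h : q ≤ j) : gridSet r q j = Iic r := if_neg (not_lt.2 h)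

lemma Iio_subset_gridSet (j : ℕ) : Iio (gridPt r q j) ⊆ gridSet r q j := by
  unfold gridPt gridSet
  split_ifs
  · exact subset_rfl
  · exact Iio_subset_Iic_self

lemma gridSet_subset_Iic (j : ℕ) : gridSet r q j ⊆ Iic (gridPt r q j) := by
  unfold gridPt gridSet
  split_ifs
  · exact Iio_subset_Iic_self
  · exact subset_rfl

lemma measurableSet_gridSet (j : ℕ) : MeasurableSet (gridSet r q j) := by
  unfold gridSet
  split_ifs
  · exact measurableSet_Iio
  · exact measurableSet_Iic

lemma gridSet_subset_succ (hr : 0 < r) (j : ℕ) : gridSet r q j ⊆ gridSet r q (j + 1) := by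
  rcases lt_or_ge j q with h | h
  · have hq : (0 : ℝ) < q := by exact_mod_cast (Nat.zero_le j).trans_lt h
    rw [gridSet_eq_of_lt h]
    rcases lt_or_ge (j + 1) q with h' | h'
    · rw [gridSet_eq_of_lt h']
      refine Iio_subset_Iio ?_
      push_cast
      gcongr
      linarith
    · rw [gridSet_eq_of_ge h']
      intro v (hv : v < _)
      have : 2 * r * j / q ≤ 2 * r := by
        rw [div_le_iff₀ hq]
        gcongr
      show v ≤ r
      linarith
  · rw [gridSet_eq_of_ge h, gridSet_eq_of_ge (h.trans j.le_succ)]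

lemma gridSet_diff_dist {j : ℕ} (hj : j < q) {v v' : ℝ}
    (hv : v ∈ gridSet r q (j + 1) \ gridSet r q j) (hv' : v' ∈ gridSet r q (j + 1) \ gridSet r q j) :
    |v - v'| ≤ 2 * r / q := by
  have hq : (0 : ℝ) < q := by exact_mod_cast (Nat.zero_le j).trans_lt hj
  have h1 : ∀ x ∈ gridSet r q (j + 1) \ gridSet r q j,
      -r + 2 * r * j / q ≤ x ∧ x ≤ -r + 2 * r * j / q + 2 * r / q := by
    rintro x ⟨hx1, hx2⟩
    rw [gridSet_eq_of_lt hj, mem_Iio, not_lt] at hx2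
    refine ⟨hx2, ?_⟩
    have e : -r + 2 * r * j / q + 2 * r / q = -r + 2 * r * (j + 1 : ℕ) / q := by
      push_cast
      ring
    rw [e]
    rcases lt_or_ge (j + 1) q with h' | h'
    · rw [gridSet_eq_of_lt h'] at hx1
      exact le_of_lt hx1
    · rw [gridSet_eq_of_ge h', mem_Iic] at hx1
      have : j + 1 = q := by omega
      rw [this, mul_div_cancel_right₀ _ hq.ne']
      linarith
  have a := h1 v hv
  have b := h1 v' hv'
  rw [abs_le]
  constructor <;> linarith

lemma gridSet_diff_zero (hq : 0 < q) : gridSet r q q \ gridSet r q 0 = Icc (-r) r := by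
  rw [gridSet_eq_of_ge le_rfl, gridSet_eq_of_lt hq]
  ext v
  simp [and_comm]

lemma gridPt_eq (hq : 0 < q) (j : ℕ) :
    ∃ m : ℚ, gridPt r q j = r * m ∧ (Odd q → m ≠ 0) := by
  have hq' : (q : ℝ) ≠ 0 := by positivity
  unfold gridPt
  split_ifs with h
  · refine ⟨(2 * j - q) / q, ?_, fun hodd => ?_⟩
    · push_cast
      field_simp
      ring
    · have hz : ((2 * j - q : ℤ) : ℚ) ≠ 0 := by
        have : (2 * j - q : ℤ) ≠ 0 := by
          obtain ⟨m, hm⟩ := hodd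
          omega
        exact_mod_cast this
      push_cast at hz
      exact div_ne_zero hz (by positivity)
  · exact ⟨1, by simp, fun _ => one_ne_zero⟩

end Grid

section Deviation

/-- The discrepancy of two measures on a chain of sets. -/
def chainDev (L : ℕ → Set ℝ) (n : ℕ) (η η' : Measure ℝ) : ENNReal :=
  ∑ j ∈ Finset.range n, (‖η.real (L j) - η'.real (L j)‖ₑ + ‖η.real (L (j + 1)) - η'.real (L (j + 1))‖ₑ)

lemma chainDev_comm (L : ℕ → Set ℝ) (n : ℕ) (η η' : Measure ℝ) :
    chainDev L n η η' = chainDev L n η' η := by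
  simp only [chainDev, enorm_sub_rev]

lemma measure_diff_le_add_enorm {η η' : Measure ℝ} [IsFiniteMeasure η] [IsFiniteMeasure η']
    {s t : Set ℝ} (hst : s ⊆ t) (hs : MeasurableSet s) :
    η (t \ s) ≤ η' (t \ s) + (‖η.real s - η'.real s‖ₑ + ‖η.real t - η'.real t‖ₑ) := by
  rw [← ofReal_measureReal, ← ofReal_measureReal (μ := η'), Real.enorm_eq_ofReal_abs,
    Real.enorm_eq_ofReal_abs, ← ENNReal.ofReal_add (abs_nonneg _) (abs_nonneg _),
    ← ENNReal.ofReal_add measureReal_nonneg (by positivity), measureReal_sdiff hst hs,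
    measureReal_sdiff hst hs]
  refine ENNReal.ofReal_le_ofReal ?_
  have h1 := neg_abs_le (η.real s - η'.real s)
  have h2 := le_abs_self (η.real t - η'.real t)
  linarith

lemma measure_inter_chain_le {η η' : Measure ℝ} [IsFiniteMeasure η] [IsFiniteMeasure η']
    {L : ℕ → Set ℝ} (hL : Monotone L) (hLm : ∀ j, MeasurableSet (L j)) {A A' : Set ℝ} (n : ℕ)
    (h : ∀ j < n, (A ∩ (L (j + 1) \ L j)).Nonempty → L (j + 1) \ L j ⊆ A') :
    η (A ∩ (L n \ L 0)) ≤ η' (A' ∩ (L n \ L 0)) + chainDev L n η η' := by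
  induction n with
  | zero => simp [chainDev]
  | succ n ih =>
    have ih := ih fun j hj => h j (hj.trans n.lt_succ_self)
    have h1 : A ∩ (L (n + 1) \ L 0) ⊆ (A ∩ (L n \ L 0)) ∪ (A ∩ (L (n + 1) \ L n)) := by
      rintro v ⟨hA, hv, hv0⟩
      by_cases hn : v ∈ L n
      · exact Or.inl ⟨hA, hn, hv0⟩
      · exact Or.inr ⟨hA, hv, hn⟩
    have h2 : η' (A' ∩ (L n \ L 0)) + η' (A' ∩ (L (n + 1) \ L n)) =
        η' (A' ∩ (L (n + 1) \ L 0)) := by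
      rw [← measure_inter_add_sdiff (A' ∩ (L (n + 1) \ L 0)) (hLm n)]
      congr 2
      · ext v
        have := @hL n (n + 1) n.le_succ v
        simp only [mem_inter_iff, Set.mem_sdiff]
        tauto
      · ext v
        have := @hL 0 n n.zero_le v
        simp only [mem_inter_iff, Set.mem_sdiff]
        tauto
    have h3 : η (A ∩ (L (n + 1) \ L n)) ≤ η' (A' ∩ (L (n + 1) \ L n)) +
        (‖η.real (L n) - η'.real (L n)‖ₑ + ‖η.real (L (n + 1)) - η'.real (L (n + 1))‖ₑ) := by
      by_cases hne : (A ∩ (L (n + 1) \ L n)).Nonempty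
      · rw [inter_eq_right.2 (h n n.lt_succ_self hne)]
        exact (measure_mono inter_subset_right).trans
          (measure_diff_le_add_enorm (hL n.le_succ) (hLm n))
      · rw [not_nonempty_iff_eq_empty.1 hne, measure_empty]
        exact zero_le
    calc η (A ∩ (L (n + 1) \ L 0)) ≤ η (A ∩ (L n \ L 0)) + η (A ∩ (L (n + 1) \ L n)) :=
          (measure_mono h1).trans (measure_union_le _ _)
      _ ≤ _ := add_le_add ih h3
      _ = _ := by
        rw [← h2, chainDev, chainDev, Finset.sum_range_succ]
        ring

/-- The vertical chain of sets around height `y` obtained from `gridSet`. -/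
def gridAt (r : ℝ) (q : ℕ) (y : ℝ) (j : ℕ) : Set ℝ := {v | v - y ∈ gridSet r q j}

variable {r : ℝ} {q : ℕ}

lemma measurableSet_gridAt (y : ℝ) (j : ℕ) : MeasurableSet (gridAt r q y j) :=
  (measurable_id.sub_const y) (measurableSet_gridSet j)

lemma gridAt_diff_zero (hq : 0 < q) (y : ℝ) :
    gridAt r q y q \ gridAt r q y 0 = closedBall y r := by
  ext v
  have := Set.ext_iff.1 (gridSet_diff_zero (r := r) hq) (v - y)
  rw [mem_closedBall, Real.dist_eq, abs_le]
  exact this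

variable {ν : Measure ℝ} [IsFiniteMeasure ν] {κ κ' : Kernel ℝ ℝ}
  [IsMarkovKernel κ] [IsMarkovKernel κ']

omit [IsMarkovKernel κ'] in
lemma compProd_inter_prod_apply {E : Set (ℝ × ℝ)} (hE : MeasurableSet E) {I V : Set ℝ}
    (hI : MeasurableSet I) (hV : MeasurableSet V) :
    (ν ⊗ₘ κ) (E ∩ I ×ˢ V) = ∫⁻ u in I, κ u (Prod.mk u ⁻¹' E ∩ V) ∂ν := by
  rw [Measure.compProd_apply (hE.inter (hI.prod hV)), ← lintegral_indicator hI]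
  refine lintegral_congr fun u => ?_
  by_cases hu : u ∈ I
  · rw [indicator_of_mem hu]
    congr 1
    ext v
    simp [hu]
  · rw [indicator_of_notMem hu]
    have : Prod.mk u ⁻¹' (E ∩ I ×ˢ V) = ∅ := by
      ext v
      simp [hu]
    rw [this, measure_empty]

omit [IsMarkovKernel κ] [IsMarkovKernel κ'] in
lemma measurable_chainDev {L : ℕ → Set ℝ} (hL : ∀ j, MeasurableSet (L j)) (n : ℕ) :
    Measurable fun u => chainDev L n (κ u) (κ' u) := by
  have : ∀ j, Measurable fun u => ‖(κ u).real (L j) - (κ' u).real (L j)‖ₑ := fun j =>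
    ((κ.measurable_coe (hL j)).ennreal_toReal.sub
      (κ'.measurable_coe (hL j)).ennreal_toReal).enorm
  exact Finset.measurable_fun_sum _ fun j _ => (this j).add (this (j + 1))

lemma compProd_zoomMap_le (hr : 0 < r) (hq : 0 < q) (z : ℝ × ℝ) (a b : ℝ) (hb : 0 < b)
    {ε : ℝ} (hε : b * (2 * r / q) < ε) {B : Set (ℝ × ℝ)} (hB : MeasurableSet B) (a' : ℝ) :
    (ν ⊗ₘ κ) (zoomMap z a b ⁻¹' B ∩ rectAt z a' r) ≤
      (ν ⊗ₘ κ') (zoomMap z a b ⁻¹' (thickening ε B) ∩ rectAt z a' r) +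
        ∫⁻ u in closedBall z.1 a', chainDev (gridAt r q z.2) q (κ u) (κ' u) ∂ν := by
  have hz := measurable_zoomMap z a b
  have hLm := measurableSet_gridAt (r := r) (q := q) z.2
  rw [rectAt, compProd_inter_prod_apply (hz hB) measurableSet_closedBall measurableSet_closedBall,
    compProd_inter_prod_apply (hz isOpen_thickening.measurableSet) measurableSet_closedBall
      measurableSet_closedBall, ← lintegral_add_right _ (measurable_chainDev hLm q)]
  refine lintegral_mono fun u => ?_
  simp only
  rw [← gridAt_diff_zero hq]
  refine measure_inter_chain_le (L := gridAt r q z.2)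
    (monotone_nat_of_le_succ fun j v hv => gridSet_subset_succ hr j hv) hLm q ?_
  rintro j hj ⟨v, hvB, hv⟩ v' hv'
  refine mem_thickening_iff.2 ⟨_, hvB, ?_⟩
  have hd := gridSet_diff_dist (r := r) hj (v := v' - z.2) (v' := v - z.2) hv' hv
  have h0 : 0 ≤ b * (2 * r / q) := by positivity
  rw [Prod.dist_eq, max_lt_iff]
  simp only [zoomMap, dist_self, Real.dist_eq]
  refine ⟨h0.trans_lt hε, lt_of_le_of_lt ?_ hε⟩
  rw [← mul_sub, abs_mul, abs_of_pos hb]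
  gcongr

end Deviation

section Normalize

open scoped NNReal

lemma inv_mul_le_inv_mul_add {α β a b D : ENNReal} (hα : α ≠ ⊤) (hβ : β ≠ ⊤) (hβ0 : β ≠ 0)
    (hab : a ≤ b + D) (hb : b ≤ β) (h : β ≤ α + D) (hD : 4 * D / β < 1) :
    α⁻¹ * a ≤ β⁻¹ * b + 4 * D / β := by
  have hDt : D ≠ ⊤ := by
    rintro rfl
    simp [ENNReal.top_div, hβ] at hD
  have hbt : b ≠ ⊤ := ne_top_of_le_ne_top hβ hb
  have hat : a ≠ ⊤ := ne_top_of_le_ne_top (ENNReal.add_ne_top.2 ⟨hbt, hDt⟩) hab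
  rw [ENNReal.div_lt_iff (Or.inl hβ0) (Or.inl hβ), one_mul] at hD
  lift α to ℝ≥0 using hα
  lift β to ℝ≥0 using hβ
  lift a to ℝ≥0 using hat
  lift b to ℝ≥0 using hbt
  lift D to ℝ≥0 using hDt
  have hβ0 : β ≠ 0 := by exact_mod_cast hβ0
  have hD : 4 * D < β := by exact_mod_cast hD
  have hab : a ≤ b + D := by exact_mod_cast hab
  have hb : b ≤ β := by exact_mod_cast hb
  have h : β ≤ α + D := by exact_mod_cast h
  have hα0 : α ≠ 0 := by
    rintro rfl
    rw [zero_add] at h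
    have : 4 * D < D := hD.trans_le h
    have h4 : D ≤ 4 * D := le_mul_of_one_le_left D.2 (by norm_num)
    exact absurd (this.trans_le h4) (lt_irrefl _)
  rw [← ENNReal.coe_inv hα0, ← ENNReal.coe_inv hβ0]
  have e : (4 * D / β : ENNReal) = ((4 * D / β : ℝ≥0) : ENNReal) := by
    rw [ENNReal.coe_div hβ0]
    push_cast
    rfl
  rw [e]
  norm_cast
  rw [← NNReal.coe_le_coe]
  have k1 : (0 : ℝ) < α := by positivity
  have k2 : (0 : ℝ) < β := by positivity
  have k3 : (4 : ℝ) * D < β := by exact_mod_cast hD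
  have k4 : (a : ℝ) ≤ b + D := by exact_mod_cast hab
  have k5 : (b : ℝ) ≤ β := by exact_mod_cast hb
  have k6 : (β : ℝ) ≤ α + D := by exact_mod_cast h
  have k7 : (0 : ℝ) ≤ D := D.2
  have k8 : (0 : ℝ) ≤ b := b.2
  push_cast
  have e2 : (β : ℝ)⁻¹ * b + 4 * D / β = (b + 4 * D) / β := by field_simp
  rw [e2, inv_mul_le_iff₀ k1, mul_div_assoc', le_div_iff₀ k2]
  nlinarith [mul_le_mul_of_nonneg_right k4 k2.le, mul_nonneg k7 k8,
    mul_le_mul_of_nonneg_left k5 k7, mul_le_mul_of_nonneg_right k6 k8,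
    mul_le_mul_of_nonneg_right k6 k7]

lemma inv_mul_le_inv_mul_add' {α β a b D : ENNReal} (hα : α ≠ ⊤) (hβ : β ≠ ⊤) (hβ0 : β ≠ 0)
    (hba : b ≤ a + D) (ha : a ≤ α) (h : β ≤ α + D) (h' : α ≤ β + D) (hD : 4 * D / β < 1) :
    β⁻¹ * b ≤ α⁻¹ * a + 4 * D / β := by
  have hDt : D ≠ ⊤ := by
    rintro rfl
    simp [ENNReal.top_div, hβ] at hD
  have hat : a ≠ ⊤ := ne_top_of_le_ne_top hα ha
  have hbt : b ≠ ⊤ := ne_top_of_le_ne_top (ENNReal.add_ne_top.2 ⟨hat, hDt⟩) hba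
  rw [ENNReal.div_lt_iff (Or.inl hβ0) (Or.inl hβ), one_mul] at hD
  lift α to ℝ≥0 using hα
  lift β to ℝ≥0 using hβ
  lift a to ℝ≥0 using hat
  lift b to ℝ≥0 using hbt
  lift D to ℝ≥0 using hDt
  have hβ0 : β ≠ 0 := by exact_mod_cast hβ0
  have hD : 4 * D < β := by exact_mod_cast hD
  have hba : b ≤ a + D := by exact_mod_cast hba
  have ha : a ≤ α := by exact_mod_cast ha
  have h : β ≤ α + D := by exact_mod_cast h
  have h' : α ≤ β + D := by exact_mod_cast h'
  have hα0 : α ≠ 0 := by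
    rintro rfl
    rw [zero_add] at h
    have : 4 * D < D := hD.trans_le h
    have h4 : D ≤ 4 * D := le_mul_of_one_le_left D.2 (by norm_num)
    exact absurd (this.trans_le h4) (lt_irrefl _)
  rw [← ENNReal.coe_inv hα0, ← ENNReal.coe_inv hβ0]
  have e : (4 * D / β : ENNReal) = ((4 * D / β : ℝ≥0) : ENNReal) := by
    rw [ENNReal.coe_div hβ0]
    push_cast
    rfl
  rw [e]
  norm_cast
  rw [← NNReal.coe_le_coe]
  have k1 : (0 : ℝ) < α := by positivity
  have k2 : (0 : ℝ) < β := by positivity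
  have k4 : (b : ℝ) ≤ a + D := by exact_mod_cast hba
  have k5 : (a : ℝ) ≤ α := by exact_mod_cast ha
  have k6 : (α : ℝ) ≤ β + D := by exact_mod_cast h'
  have k7 : (0 : ℝ) ≤ D := D.2
  have k8 : (0 : ℝ) ≤ a := a.2
  push_cast
  rw [inv_mul_le_iff₀ k2, mul_add, mul_div_cancel₀ _ k2.ne', ← mul_assoc]
  have k9 : (a : ℝ) - D ≤ β * (α : ℝ)⁻¹ * a := by
    rw [← div_eq_mul_inv, div_mul_eq_mul_div, le_div_iff₀ k1]
    nlinarith [mul_le_mul_of_nonneg_right k6 k8, mul_le_mul_of_nonneg_right k5 k7]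
  linarith

end Normalize

section Disintegration

lemma ae_eq_condKernel_of_measure_eq_lintegral {μ : Measure (ℝ × ℝ)} [IsProbabilityMeasure μ]
    {μx : ℝ → Measure ℝ} (hprob : ∀ x, IsProbabilityMeasure (μx x))
    (hdis : ∀ A : Set (ℝ × ℝ), MeasurableSet A →
      μ A = ∫⁻ x, (μx x) {v : ℝ | (x, v) ∈ A} ∂(μ.map Prod.fst)) :
    ∀ᵐ x ∂(μ.map Prod.fst), μx x = μ.condKernel x := by
  set ν := μ.map Prod.fst with hν
  have : IsProbabilityMeasure ν := Measure.isProbabilityMeasure_map measurable_fst.aemeasurable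
  have hκ : ν ⊗ₘ μ.condKernel = μ := μ.disintegrate μ.condKernel
  have hmeas : ∀ V, MeasurableSet V → AEMeasurable (fun x => μx x V) ν := by
    intro V hV
    have e : ∀ W : Set ℝ, MeasurableSet W → ∫⁻ x, μx x W ∂ν = μ (univ ×ˢ W) := fun W hW => by
      rw [hdis _ (MeasurableSet.univ.prod hW)]
      simp
    obtain ⟨h, hm, hle, heq⟩ := exists_measurable_le_lintegral_eq ν fun x => μx x V
    obtain ⟨h', hm', hle', heq'⟩ := exists_measurable_le_lintegral_eq ν fun x => μx x Vᶜ
    rw [e V hV] at heq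
    rw [e _ hV.compl] at heq'
    have hsum : ∀ x, μx x V + μx x Vᶜ = 1 := fun x => by
      rw [measure_add_measure_compl hV, measure_univ]
    have h1 : ∫⁻ x, 1 ∂ν ≤ ∫⁻ x, (h x + h' x) ∂ν := by
      rw [lintegral_add_left hm, ← heq, ← heq', lintegral_one, measure_univ]
      have : (univ ×ˢ Vᶜ : Set (ℝ × ℝ)) = (univ ×ˢ V)ᶜ := by
        ext
        simp
      rw [this, measure_add_measure_compl (MeasurableSet.univ.prod hV), measure_univ]
    have h2 : ∀ x, h x + h' x ≤ 1 := fun x => (add_le_add (hle x) (hle' x)).trans (hsum x).le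
    have h3 := ae_eq_of_ae_le_of_lintegral_le (ae_of_all ν h2)
      (((lintegral_mono h2).trans_lt (by simp)).ne) aemeasurable_const h1
    refine ⟨h, hm, ?_⟩
    filter_upwards [h3] with x hx
    refine le_antisymm ?_ (hle x)
    have hfin : h' x ≠ ⊤ := ne_top_of_le_ne_top ENNReal.one_ne_top (le_add_self.trans (h2 x))
    refine (ENNReal.add_le_add_iff_right hfin).1 ?_
    rw [hx, ← hsum x]
    exact add_le_add le_rfl (hle' x)
  have hV : ∀ V, MeasurableSet V → ∀ᵐ x ∂ν, μx x V = μ.condKernel x V := by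
    intro V hV
    refine ae_eq_of_forall_setLIntegral_eq_of_sigmaFinite₀ (hmeas V hV)
      (μ.condKernel.measurable_coe hV).aemeasurable fun U hU _ => ?_
    rw [← Measure.compProd_apply_prod hU hV, hκ, hdis _ (hU.prod hV), ← lintegral_indicator hU]
    refine lintegral_congr fun x => ?_
    by_cases hx : x ∈ U <;> simp [hx]
  filter_upwards [ae_all_iff.2 fun q : ℚ => hV (Iio (q : ℝ)) measurableSet_Iio] with x hx
  refine ext_of_generate_finite _ Real.borel_eq_generateFrom_Iio_rat Real.isPiSystem_Iio_rat
    ?_ (by simp)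
  intro s hs
  simp only [mem_iUnion, mem_singleton_iff] at hs
  obtain ⟨q, rfl⟩ := hs
  exact hx q

end Disintegration

section Lebesgue

variable {ν : Measure ℝ} [IsFiniteMeasure ν] {κ : Kernel ℝ ℝ} [IsMarkovKernel κ]

lemma enorm_measureReal_sub_le {η η' : Measure ℝ} [IsFiniteMeasure η] [IsFiniteMeasure η']
    {s t L : Set ℝ} (hs : MeasurableSet s) (hsL : s ⊆ L) (hLt : L ⊆ t) :
    ‖η.real L - η'.real L‖ₑ ≤
      ‖η.real s - η'.real s‖ₑ + ‖η.real t - η'.real t‖ₑ + η' (t \ s) := by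
  rw [← ofReal_measureReal (μ := η'), Real.enorm_eq_ofReal_abs, Real.enorm_eq_ofReal_abs,
    Real.enorm_eq_ofReal_abs, ← ENNReal.ofReal_add (abs_nonneg _) (abs_nonneg _),
    ← ENNReal.ofReal_add (by positivity) measureReal_nonneg,
    measureReal_sdiff (hsL.trans hLt) hs]
  refine ENNReal.ofReal_le_ofReal (abs_le.2 ?_)
  have m1 : η.real s ≤ η.real L := measureReal_mono hsL
  have m2 : η.real L ≤ η.real t := measureReal_mono hLt
  have m3 : η'.real s ≤ η'.real L := measureReal_mono hsL
  have m4 : η'.real L ≤ η'.real t := measureReal_mono hLt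
  have a1 := abs_le.1 (le_refl |η.real s - η'.real s|)
  have a2 := abs_le.1 (le_refl |η.real t - η'.real t|)
  constructor <;> linarith [abs_nonneg (η.real s - η'.real s), abs_nonneg (η.real t - η'.real t)]

variable (ν κ) in
lemma ae_tendsto_average_enorm_sub : ∀ᵐ x ∂ν, ∀ t, κ x {t} = 0 → ∀ L, Iio t ⊆ L → L ⊆ Iic t →
    Tendsto (fun a => (∫⁻ u in closedBall x a, ‖(κ u).real L - (κ x).real L‖ₑ ∂ν) /
      ν (closedBall x a)) (𝓝[>] 0) (𝓝 0) := by
  have hm : ∀ s : Set ℝ, MeasurableSet s → Measurable fun u => (κ u).real s := fun s hs =>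
    (κ.measurable_coe hs).ennreal_toReal
  have hint : ∀ q : ℚ, LocallyIntegrable (fun u => (κ u).real (Iio (q : ℝ))) ν := fun q =>
    (Integrable.of_bound (hm _ measurableSet_Iio).aestronglyMeasurable 1
      (ae_of_all _ fun u => by
        rw [Real.norm_of_nonneg measureReal_nonneg]
        exact measureReal_le_one)).locallyIntegrable
  filter_upwards [ae_all_iff.2 fun q : ℚ =>
    (Besicovitch.vitaliFamily ν).ae_tendsto_lintegral_enorm_sub_div (hint q)]
    with x hx t ht L hL1 hL2
  have hx' := fun q => (hx q).comp (Besicovitch.tendsto_filterAt ν x)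
  rw [ENNReal.tendsto_nhds_zero]
  intro ε hε
  have hε3 : 0 < ε / 3 := ENNReal.div_pos hε.ne' (by simp)
  obtain ⟨U, hU, hUo, hUε⟩ := Set.exists_isOpen_lt_of_lt {t} (ε / 3) (ht.symm ▸ hε3)
  obtain ⟨d, hd, hdU⟩ := Metric.isOpen_iff.1 hUo t (hU rfl)
  obtain ⟨q₁, hq₁, hq₁t⟩ := exists_rat_btwn (sub_lt_self t hd)
  obtain ⟨q₂, hq₂t, hq₂⟩ := exists_rat_btwn (lt_add_of_pos_right t hd)
  have hκ : κ x (Iio (q₂ : ℝ) \ Iio (q₁ : ℝ)) ≤ ε / 3 := by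
    refine (measure_mono fun v hv => hdU ?_).trans hUε.le
    rw [Set.mem_sdiff, mem_Iio, mem_Iio, not_lt] at hv
    rw [mem_ball, Real.dist_eq, abs_lt]
    constructor <;> linarith [hv.1, hv.2]
  filter_upwards [ENNReal.tendsto_nhds_zero.1 (hx' q₁) _ hε3,
    ENNReal.tendsto_nhds_zero.1 (hx' q₂) _ hε3] with a h1 h2
  calc (∫⁻ u in closedBall x a, ‖(κ u).real L - (κ x).real L‖ₑ ∂ν) / ν (closedBall x a)
      ≤ (∫⁻ u in closedBall x a, (‖(κ u).real (Iio (q₁ : ℝ)) - (κ x).real (Iio (q₁ : ℝ))‖ₑ +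
        ‖(κ u).real (Iio (q₂ : ℝ)) - (κ x).real (Iio (q₂ : ℝ))‖ₑ + ε / 3) ∂ν) /
          ν (closedBall x a) := by
        refine ENNReal.div_le_div_right (lintegral_mono fun u => ?_) _
        refine (enorm_measureReal_sub_le measurableSet_Iio ?_ ?_).trans (add_le_add le_rfl hκ)
        · exact (Iio_subset_Iio hq₁t.le).trans hL1
        · exact hL2.trans (Iic_subset_Iio.2 hq₂t)
    _ ≤ ε / 3 + ε / 3 + ε / 3 := by
        have m1 : ∀ q : ℚ, Measurable fun u =>
            ‖(κ u).real (Iio (q : ℝ)) - (κ x).real (Iio (q : ℝ))‖ₑ := fun q =>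
          ((hm _ measurableSet_Iio).sub_const _).enorm
        rw [lintegral_add_right _ measurable_const, lintegral_add_left (m1 q₁),
          setLIntegral_const, ENNReal.add_div, ENNReal.add_div]
        exact add_le_add (add_le_add h1 h2) (ENNReal.div_le_of_le_mul le_rfl)
    _ = ε := ENNReal.add_thirds ε

variable (ν κ) in
lemma ae_tendsto_average_chainDev : ∀ᵐ x ∂ν, ∀ (L : ℕ → Set ℝ) (t : ℕ → ℝ) (n : ℕ),
    (∀ j, MeasurableSet (L j)) → (∀ j, Iio (t j) ⊆ L j) → (∀ j, L j ⊆ Iic (t j)) →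
    (∀ j, κ x {t j} = 0) →
    Tendsto (fun a => (∫⁻ u in closedBall x a, chainDev L n (κ u) (κ x) ∂ν) /
      ν (closedBall x a)) (𝓝[>] 0) (𝓝 0) := by
  filter_upwards [ae_tendsto_average_enorm_sub ν κ] with x hx L t n hLm hL1 hL2 ht
  have hm : ∀ j, Measurable fun u => ‖(κ u).real (L j) - (κ x).real (L j)‖ₑ := fun j =>
    ((κ.measurable_coe (hLm j)).ennreal_toReal.sub_const _).enorm
  have h := fun j => hx (t j) (ht j) (L j) (hL1 j) (hL2 j)
  have key := tendsto_finsetSum (Finset.range n) fun j _ => (h j).add (h (j + 1))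
  simp only [add_zero, Finset.sum_const_zero] at key
  refine key.congr fun a => ?_
  simp only [chainDev]
  have hm' : ∀ j, Measurable fun u => ‖(κ u).real (L j) - (κ x).real (L j)‖ₑ +
      ‖(κ u).real (L (j + 1)) - (κ x).real (L (j + 1))‖ₑ := fun j => (hm j).add (hm (j + 1))
  rw [lintegral_finsetSum _ fun j _ => hm' j, div_eq_mul_inv, Finset.sum_mul]
  refine Finset.sum_congr rfl fun j _ => ?_
  rw [lintegral_add_left (hm j), div_eq_mul_inv, div_eq_mul_inv, add_mul]

end Lebesgue

section Atoms

lemma exists_radius_forall_rat_no_atom (μ : Measure (ℝ × ℝ)) [IsProbabilityMeasure μ]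
    (κ : Kernel ℝ ℝ) [IsMarkovKernel κ] {δ : ℝ} (hδ : 0 < δ) :
    ∃ r, 0 < r ∧ r < δ ∧ ∀ᵐ z ∂μ, ∀ m : ℚ, m ≠ 0 → κ z.1 {z.2 + r * m} = 0 := by
  set κ' : Kernel (ℝ × ℝ) ℝ := κ.comap Prod.fst measurable_fst
  have hf : Measurable fun q : (ℝ × ℝ) × ℝ => q.2 - q.1.2 := by fun_prop
  set θ := (μ ⊗ₘ κ').map fun q : (ℝ × ℝ) × ℝ => q.2 - q.1.2 with hθ
  have hcount : {τ : ℝ | 0 < θ {τ}}.Countable :=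
    Measure.countable_meas_pos_of_disjoint_iUnion (fun τ => measurableSet_singleton τ)
      fun a b hab => by simpa using hab
  have hbad : (⋃ m : ℚ, (fun τ => τ / (m : ℝ)) '' {τ : ℝ | 0 < θ {τ}}).Countable :=
    countable_iUnion fun m => hcount.image _
  obtain ⟨r, hr, hr'⟩ := (hbad.dense_compl ℝ).exists_mem_open isOpen_Ioo (nonempty_Ioo.2 hδ)
  refine ⟨r, hr'.1, hr'.2, ae_all_iff.2 fun m => ?_⟩
  by_cases hm : m = 0
  · exact ae_of_all _ fun z h => absurd hm h
  have hm' : (m : ℝ) ≠ 0 := by exact_mod_cast hm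
  have h0 : θ {r * m} = 0 := by
    by_contra h
    refine hr (mem_iUnion.2 ⟨m, r * m, pos_iff_ne_zero.2 h, ?_⟩)
    simp [hm']
  rw [hθ, Measure.map_apply hf (measurableSet_singleton _),
    Measure.compProd_apply (hf (measurableSet_singleton _)),
    lintegral_eq_zero_iff (Kernel.measurable_kernel_prodMk_left
      (hf (measurableSet_singleton _)))] at h0
  filter_upwards [h0] with z hz _
  have e : Prod.mk z ⁻¹' ((fun q : (ℝ × ℝ) × ℝ => q.2 - q.1.2) ⁻¹' {r * m}) =
      {z.2 + r * m} := by
    ext v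
    simp [sub_eq_iff_eq_add']
  rw [e] at hz
  exact hz

end Atoms

section SceneDeviation

/-- A quantity controlling the Lévy–Prokhorov distance, on the rectangle around `z` with
half-widths `a` and `r`, between the normalized restrictions of `ν ⊗ₘ κ` and `ν × κ z.1`. -/
def sceneDev (ν : Measure ℝ) (κ : Kernel ℝ ℝ) (r : ℝ) (q : ℕ) (z : ℝ × ℝ) (a : ℝ) : ENNReal :=
  4 * (∫⁻ u in closedBall z.1 a, chainDev (gridAt r q z.2) q (κ u) (κ z.1) ∂ν) /
    (ν (closedBall z.1 a) * κ z.1 (closedBall z.2 r))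

variable {ν : Measure ℝ} [IsFiniteMeasure ν] {κ : Kernel ℝ ℝ} [IsMarkovKernel κ]

lemma levyProkhorovEDist_zoomed_le {c : ℝ} {q : ℕ} (hq : 0 < q) (z : ℝ × ℝ) (s : ℝ)
    (hν : ν (closedBall z.1 ((2 : ℝ) ^ (-(s + c)))) ≠ 0)
    (hκ : κ z.1 (closedBall z.2 ((2 : ℝ) ^ (-c))) ≠ 0) :
    levyProkhorovEDist (zoomed (ν ⊗ₘ κ) z s c) (zoomed (ν.prod (κ z.1)) z s c) ≤
      ENNReal.ofReal (3 / q) +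
        min 1 (sceneDev ν κ ((2 : ℝ) ^ (-c)) q z ((2 : ℝ) ^ (-(s + c)))) := by
  set r : ℝ := (2 : ℝ) ^ (-c) with hr
  set a : ℝ := (2 : ℝ) ^ (-(s + c)) with ha
  have hr0 : 0 < r := by positivity
  have hq0 : (0 : ℝ) < q := by exact_mod_cast hq
  rcases le_or_gt 1 (sceneDev ν κ r q z a) with h1 | h1
  · rw [min_eq_left h1]
    exact (levyProkhorovEDist_le_max_measure_univ _ _).trans
      ((max_le (zoomed_univ_le _ _ _ _) (zoomed_univ_le _ _ _ _)).trans le_add_self)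
  rw [min_eq_right h1.le]
  set D := ∫⁻ u in closedBall z.1 a, chainDev (gridAt r q z.2) q (κ u) (κ z.1) ∂ν with hD
  have hβ : (ν.prod (κ z.1)) (rectAt z a r) = ν (closedBall z.1 a) * κ z.1 (closedBall z.2 r) := by
    rw [rectAt, Measure.prod_prod]
  have hdev : sceneDev ν κ r q z a = 4 * D / (ν.prod (κ z.1)) (rectAt z a r) := by
    rw [sceneDev, hβ]
  have hβ0 : (ν.prod (κ z.1)) (rectAt z a r) ≠ 0 := hβ ▸ mul_ne_zero hν hκ
  rw [hdev] at h1 ⊢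
  have hconst : ν ⊗ₘ Kernel.const ℝ (κ z.1) = ν.prod (κ z.1) := Measure.compProd_const
  have hb : (2 : ℝ) ^ c * (2 * r / q) = 2 / q := by
    have : (2 : ℝ) ^ c * r = 1 := by
      rw [hr, ← Real.rpow_add two_pos, add_neg_cancel, Real.rpow_zero]
    calc (2 : ℝ) ^ c * (2 * r / q) = 2 / q * ((2 : ℝ) ^ c * r) := by ring
      _ = 2 / q := by rw [this, mul_one]
  have hε : ∀ ε : ℝ, 3 / q < ε → (2 : ℝ) ^ c * (2 * r / q) < ε := fun ε h => by
    rw [hb]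
    refine lt_trans ?_ h
    gcongr
    norm_num
  have le₁ : ∀ (ε : ℝ) (B : Set (ℝ × ℝ)), 3 / q < ε → MeasurableSet B →
      (ν ⊗ₘ κ) (zoomMap z (2 ^ (s + c)) (2 ^ c) ⁻¹' B ∩ rectAt z a r) ≤
        (ν.prod (κ z.1)) (zoomMap z (2 ^ (s + c)) (2 ^ c) ⁻¹' thickening ε B ∩ rectAt z a r) +
          D := fun ε B h hB => by
    rw [← hconst]
    exact compProd_zoomMap_le hr0 hq z _ _ (by positivity) (hε ε h) hB a
  have le₂ : ∀ (ε : ℝ) (B : Set (ℝ × ℝ)), 3 / q < ε → MeasurableSet B →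
      (ν.prod (κ z.1)) (zoomMap z (2 ^ (s + c)) (2 ^ c) ⁻¹' B ∩ rectAt z a r) ≤
        (ν ⊗ₘ κ) (zoomMap z (2 ^ (s + c)) (2 ^ c) ⁻¹' thickening ε B ∩ rectAt z a r) +
          D := fun ε B h hB => by
    rw [← hconst, hD]
    simp only [chainDev_comm _ _ _ (κ z.1)]
    exact compProd_zoomMap_le hr0 hq z _ _ (by positivity) (hε ε h) hB a
  have hαβ : (ν ⊗ₘ κ) (rectAt z a r) ≤ (ν.prod (κ z.1)) (rectAt z a r) + D := by
    have := le₁ (3 / q + 1) univ (lt_add_one _) MeasurableSet.univ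
    rw [preimage_univ, univ_inter] at this
    exact this.trans (add_le_add (measure_mono inter_subset_right) le_rfl)
  have hβα : (ν.prod (κ z.1)) (rectAt z a r) ≤ (ν ⊗ₘ κ) (rectAt z a r) + D := by
    have := le₂ (3 / q + 1) univ (lt_add_one _) MeasurableSet.univ
    rw [preimage_univ, univ_inter] at this
    exact this.trans (add_le_add (measure_mono inter_subset_right) le_rfl)
  refine levyProkhorovEDist_le_of_forall _ _ _ fun ε B hεB hεt hB => ?_
  have hε3 : 3 / q < ε.toReal :=
    (ENNReal.ofReal_lt_iff_lt_toReal (by positivity) hεt.ne).1 (le_self_add.trans_lt hεB)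
  have hDε := (le_add_self.trans hεB.le :
    4 * D / (ν.prod (κ z.1)) (rectAt z a r) ≤ ε)
  have hT : MeasurableSet (thickening ε.toReal B) := isOpen_thickening.measurableSet
  rw [zoomed_apply _ _ _ _ hB, zoomed_apply _ _ _ _ hT, zoomed_apply _ _ _ _ hB,
    zoomed_apply _ _ _ _ hT]
  constructor
  · exact (inv_mul_le_inv_mul_add (measure_ne_top _ _) (measure_ne_top _ _) hβ0
      (le₁ _ B hε3 hB) (measure_mono inter_subset_right) hβα h1).trans (add_le_add le_rfl hDε)
  · exact (inv_mul_le_inv_mul_add' (measure_ne_top _ _) (measure_ne_top _ _) hβ0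
      (le₂ _ B hε3 hB) (measure_mono inter_subset_right) hβα hαβ h1).trans
      (add_le_add le_rfl hDε)

omit [IsFiniteMeasure ν] in
lemma measurable_kernel_closedBall (r : ℝ) :
    Measurable fun z : ℝ × ℝ => κ z.1 (closedBall z.2 r) := by
  have hs : MeasurableSet {p : (ℝ × ℝ) × ℝ | dist p.2 p.1.2 ≤ r} :=
    measurableSet_le (by fun_prop) measurable_const
  exact Kernel.measurable_kernel_prodMk_left (κ := κ.comap Prod.fst measurable_fst) hs

variable (ν κ) in
lemma measurable_sceneDev (r : ℝ) (q : ℕ) (a : ℝ) :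
    Measurable fun z : ℝ × ℝ => sceneDev ν κ r q z a := by
  have hs : MeasurableSet {p : (ℝ × ℝ) × ℝ | dist p.2 p.1.1 ≤ a} :=
    measurableSet_le (by fun_prop) measurable_const
  have h1 : Measurable fun z : ℝ × ℝ => ν (closedBall z.1 a) := measurable_measure_prodMk_left hs
  have hg : ∀ j, MeasurableSet {p : ((ℝ × ℝ) × ℝ) × ℝ | p.2 ∈ gridAt r q p.1.1.2 j} := fun j =>
    (show Measurable fun p : ((ℝ × ℝ) × ℝ) × ℝ => p.2 - p.1.1.2 by fun_prop)
      (measurableSet_gridSet j)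
  have h2 : ∀ j, Measurable fun p : (ℝ × ℝ) × ℝ => (κ p.2).real (gridAt r q p.1.2 j) := fun j =>
    (Kernel.measurable_kernel_prodMk_left (κ := κ.comap Prod.snd measurable_snd)
      (hg j)).ennreal_toReal
  have h3 : ∀ j, Measurable fun p : (ℝ × ℝ) × ℝ => (κ p.1.1).real (gridAt r q p.1.2 j) :=
    fun j => (Kernel.measurable_kernel_prodMk_left
      (κ := κ.comap (fun p : (ℝ × ℝ) × ℝ => p.1.1) (by fun_prop)) (hg j)).ennreal_toReal
  have h4 : Measurable fun p : (ℝ × ℝ) × ℝ =>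
      chainDev (gridAt r q p.1.2) q (κ p.2) (κ p.1.1) :=
    Finset.measurable_fun_sum _ fun j _ =>
      ((h2 j).sub (h3 j)).enorm.add ((h2 (j + 1)).sub (h3 (j + 1))).enorm
  have h5 : Measurable fun z : ℝ × ℝ =>
      ∫⁻ u in closedBall z.1 a, chainDev (gridAt r q z.2) q (κ u) (κ z.1) ∂ν := by
    simp only [← lintegral_indicator measurableSet_closedBall]
    exact (h4.indicator hs).lintegral_prod_right' (ν := ν)
  exact (h5.const_mul 4).div (h1.mul (measurable_kernel_closedBall r))

lemma ae_sceneDev_tendsto {μ : Measure (ℝ × ℝ)} [IsProbabilityMeasure μ] {κ : Kernel ℝ ℝ}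
    [IsMarkovKernel κ] (hκ : μ.map Prod.fst ⊗ₘ κ = μ) {r : ℝ} (hr : 0 < r)
    (hat : ∀ᵐ z ∂μ, ∀ m : ℚ, m ≠ 0 → κ z.1 {z.2 + r * m} = 0) :
    ∀ᵐ z ∂μ, (∀ a > 0, μ.map Prod.fst (closedBall z.1 a) ≠ 0) ∧
      κ z.1 (closedBall z.2 r) ≠ 0 ∧
      ∀ q : ℕ, Odd q → Tendsto (sceneDev (μ.map Prod.fst) κ r q z) (𝓝[>] 0) (𝓝 0) := by
  set ν := μ.map Prod.fst with hν
  have : IsProbabilityMeasure ν := Measure.isProbabilityMeasure_map measurable_fst.aemeasurable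
  have hpos : ∀ (η : Measure ℝ) (x a : ℝ), x ∈ η.support → 0 < a → η (closedBall x a) ≠ 0 :=
    fun η x a hx ha => ((Measure.mem_support_iff_forall x).1 hx _ (closedBall_mem_nhds x ha)).ne'
  have k1 : ∀ᵐ x ∂ν, ∀ a > 0, ν (closedBall x a) ≠ 0 := by
    filter_upwards [Measure.support_mem_ae (μ := ν)] with x hx a ha using hpos ν x a hx ha
  have k2 : ∀ᵐ z ∂μ, κ z.1 (closedBall z.2 r) ≠ 0 := by
    rw [← hκ]
    refine Measure.ae_compProd_of_ae_ae
      ((measurable_kernel_closedBall r) (measurableSet_singleton (0 : ENNReal)).compl) ?_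
    refine ae_of_all _ fun x => ?_
    filter_upwards [Measure.support_mem_ae (μ := κ x)] with y hy using hpos _ y r hy hr
  filter_upwards [ae_of_ae_map measurable_fst.aemeasurable k1, k2,
    ae_of_ae_map measurable_fst.aemeasurable (ae_tendsto_average_chainDev ν κ), hat]
    with z h1 h2 h3 h4
  refine ⟨h1, h2, fun q hq => ?_⟩
  have := h3 (gridAt r q z.2) (fun j => z.2 + gridPt r q j) q (fun j => measurableSet_gridAt _ _)
    (fun j v hv => Iio_subset_gridSet j (mem_Iio.2 (sub_lt_iff_lt_add'.2 hv)))
    (fun j v hv => sub_le_iff_le_add'.1 (mem_Iic.1 (gridSet_subset_Iic j hv)))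
    fun j => by
      obtain ⟨m, hm, hm0⟩ := gridPt_eq (r := r) hq.pos j
      rw [hm]
      exact h4 m (hm0 hq)
  have h := ENNReal.Tendsto.const_mul (a := 4 * (κ z.1 (closedBall z.2 r))⁻¹) this
    (Or.inr (ENNReal.mul_ne_top (by simp) (ENNReal.inv_ne_top.2 h2)))
  rw [mul_zero] at h
  refine h.congr fun a => ?_
  rw [sceneDev, div_eq_mul_inv, div_eq_mul_inv, ENNReal.mul_inv (Or.inr (measure_ne_top _ _))
    (Or.inr h2)]
  ring

/-- The supremum of the truncated deviations over the scales `2 ^ (-(e i + c))` with `N ≤ e i`. -/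
def sceneSup {ι : Type*} (ν : Measure ℝ) (κ : Kernel ℝ ℝ) (e : ι → ℝ) (c : ℝ) (q N : ℕ)
    (z : ℝ × ℝ) : ENNReal :=
  ⨆ (i : ι) (_ : (N : ℝ) ≤ e i),
    min 1 (sceneDev ν κ ((2 : ℝ) ^ (-c)) q z ((2 : ℝ) ^ (-(e i + c))))

variable {ι : Type*} {e : ι → ℝ} {c : ℝ} {q N : ℕ}

variable (ν κ) in
lemma measurable_sceneSup [Countable ι] : Measurable (sceneSup ν κ e c q N) :=
  Measurable.iSup fun _ => Measurable.iSup fun _ =>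
    measurable_const.min (measurable_sceneDev ν κ _ q _)

omit [IsFiniteMeasure ν] [IsMarkovKernel κ] in
lemma sceneSup_le_one (z : ℝ × ℝ) : sceneSup ν κ e c q N z ≤ 1 :=
  iSup₂_le fun _ _ => min_le_left _ _

omit [IsFiniteMeasure ν] [IsMarkovKernel κ] in
lemma tendsto_sceneSup {z : ℝ × ℝ}
    (h : Tendsto (sceneDev ν κ ((2 : ℝ) ^ (-c)) q z) (𝓝[>] 0) (𝓝 0)) :
    Tendsto (fun N => sceneSup ν κ e c q N z) atTop (𝓝 0) := by
  have h0 : Tendsto (fun t : ℝ => (2 : ℝ) ^ (-(t + c))) atTop (𝓝[>] 0) := by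
    refine tendsto_nhdsWithin_iff.2 ⟨?_, Eventually.of_forall fun t => by
      show (0 : ℝ) < _
      positivity⟩
    refine (tendsto_rpow_atBot_of_base_gt_one 2 one_lt_two).comp ?_
    exact tendsto_neg_atTop_atBot.comp (tendsto_atTop_add_const_right _ _ tendsto_id)
  rw [ENNReal.tendsto_nhds_zero]
  intro ε hε
  obtain ⟨T, hT⟩ := eventually_atTop.1 (ENNReal.tendsto_nhds_zero.1 (h.comp h0) ε hε)
  filter_upwards [tendsto_natCast_atTop_atTop.eventually_ge_atTop T] with N hN
  exact iSup₂_le fun i hi => (min_le_right _ _).trans (hT _ (hN.trans hi))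

end SceneDeviation

section Average

lemma magnify2_univ_le {E : Type*} [NormedAddCommGroup E] [NormedSpace ℝ E] [MeasurableSpace E]
    [BorelSpace E] (η : Measure E) (z : E) (t : ℝ) : magnify2 η z t univ ≤ 1 := by
  have hm : Measurable fun y => (2 : ℝ) ^ t • (y - z) :=
    ((continuous_id.sub continuous_const).const_smul _).measurable
  rw [magnify2, Measure.smul_apply, Measure.map_apply hm MeasurableSet.univ, preimage_univ,
    Measure.restrict_apply_univ]
  exact ENNReal.inv_mul_le_one _

lemma renormTo_univ_le {X : Type*} [MeasurableSpace X] (A : Set X) (m : Measure X) :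
    renormTo A m univ ≤ 1 := by
  rw [renormTo, Measure.smul_apply, Measure.restrict_apply_univ]
  exact ENNReal.inv_mul_le_one _

lemma tendsto_cesaro_zero {d : ℕ → ENNReal} (hd : ∀ k, d k ≤ 1)
    (h : ∀ ε : ℝ, 0 < ε → ∃ g : ℕ → ENNReal, (∀ᶠ k in atTop, d k ≤ ENNReal.ofReal ε + g k) ∧
      ∀ n : ℕ, ∑ k ∈ Finset.range n, g k ≤ ENNReal.ofReal ε * n) :
    Tendsto (fun n : ℕ => (n : ENNReal)⁻¹ * ∑ k ∈ Finset.range n, d k) atTop (𝓝 0) := by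
  rw [ENNReal.tendsto_nhds_zero]
  intro δ hδ
  have hδ3 : 0 < δ / 3 := ENNReal.div_pos hδ.ne' (by simp)
  obtain ⟨ε, hε, hεδ⟩ : ∃ ε : ℝ, 0 < ε ∧ ENNReal.ofReal ε ≤ δ / 3 := by
    obtain ⟨x, hx0, hx⟩ := ENNReal.lt_iff_exists_nnreal_btwn.1 hδ3
    exact ⟨x, by exact_mod_cast hx0, by simpa using hx.le⟩
  obtain ⟨g, hg, hgs⟩ := h ε hε
  obtain ⟨k₀, hk₀⟩ := eventually_atTop.1 hg
  have hlim : Tendsto (fun n : ℕ => (k₀ : ENNReal) * (n : ENNReal)⁻¹) atTop (𝓝 0) := by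
    simpa using ENNReal.Tendsto.const_mul ENNReal.tendsto_inv_nat_nhds_zero
      (Or.inr (ENNReal.natCast_ne_top k₀))
  filter_upwards [ENNReal.tendsto_nhds_zero.1 hlim _ hδ3] with n hn
  have hbound : ∀ k, d k ≤ ENNReal.ofReal ε + g k + if k < k₀ then 1 else 0 := fun k => by
    split_ifs with hk
    · exact (hd k).trans le_add_self
    · simpa using hk₀ k (not_lt.1 hk)
  have hcard : ∑ k ∈ Finset.range n, (if k < k₀ then (1 : ENNReal) else 0) ≤ k₀ := by
    rw [Finset.sum_ite, Finset.sum_const_zero, add_zero, Finset.sum_const, nsmul_eq_mul, mul_one]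
    refine Nat.cast_le.2 ((Finset.card_le_card fun k hk => ?_).trans (Finset.card_range k₀).le)
    exact Finset.mem_range.2 (Finset.mem_filter.1 hk).2
  calc (n : ENNReal)⁻¹ * ∑ k ∈ Finset.range n, d k
      ≤ (n : ENNReal)⁻¹ * (ENNReal.ofReal ε * n + ENNReal.ofReal ε * n + k₀) := by
        gcongr
        refine (Finset.sum_le_sum fun k _ => hbound k).trans ?_
        rw [Finset.sum_add_distrib, Finset.sum_add_distrib, Finset.sum_const, Finset.card_range,
          nsmul_eq_mul, mul_comm (n : ENNReal)]
        exact add_le_add (add_le_add le_rfl (hgs n)) hcard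
    _ = ENNReal.ofReal ε * ((n : ENNReal)⁻¹ * n) + ENNReal.ofReal ε * ((n : ENNReal)⁻¹ * n) +
        k₀ * (n : ENNReal)⁻¹ := by ring
    _ ≤ δ / 3 * 1 + δ / 3 * 1 + δ / 3 := by
        gcongr
        · exact ENNReal.inv_mul_le_one _
        · exact ENNReal.inv_mul_le_one _
    _ = δ := by rw [mul_one, ENNReal.add_thirds]

end Average

end Preliminaries

/-- **Lemma 6.3 (sceneries of self-affine measures).** There is `c > 0` such that for
`μ̄`-a.e. `ω`, the base-2 magnifications `μ_{Π(ω), −log₂λ_{ω|k}+c}` are, in average over `k`,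
asymptotic to rescaled products `(π_*μ)_{x_k,s_k} × μ_{σ^kω}`. -/
theorem scenery_product_structure_self_affine
    {Λ : Type} [Fintype Λ] [MeasurableSpace Λ] [MeasurableSingletonClass Λ]
    (hΛ : 2 ≤ Fintype.card Λ)
    (Φ : DiagIFS Λ) (K : Set (ℝ × ℝ)) (hK : Φ.IsAttractor K) (hsep : Φ.RSSC)
    (proj : (ℕ → Λ) → ℝ × ℝ) (hproj : Φ.IsCanonicalProj proj)
    (p : Λ → ℝ) (hp : ∀ i, 0 < p i) (hp1 : ∑ i, p i = 1)
    (μbar : Measure (ℕ → Λ)) (hbern : IsBernoulli μbar p)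
    (μ : Measure (ℝ × ℝ)) (hμ : μ = μbar.map proj)
    (hLyap : ∑ i, p i * Real.log (Φ.lam i) < ∑ i, p i * Real.log (Φ.rho i))
    (μx : ℝ → Measure ℝ)
    (hprob : ∀ x, IsProbabilityMeasure (μx x))
    (hxsupp : ∀ x, (μx x) (Icc (-1 : ℝ) 1)ᶜ = 0)
    (hdis : ∀ A : Set (ℝ × ℝ), MeasurableSet A →
      μ A = ∫⁻ x, (μx x) {v : ℝ | (x, v) ∈ A} ∂(μ.map Prod.fst)) :
    ∃ c : ℝ, 0 < c ∧
      ∀ᵐ ω ∂μbar,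
        Tendsto (fun n : ℕ => ((n : ENNReal))⁻¹ * ∑ k ∈ Finset.range n,
          levyProkhorovEDist
            (magnify2 μ (proj ω) (-Real.logb 2 (Φ.wordLam (prefixList ω k)) + c))
            (renormTo (closedBall (0 : ℝ × ℝ) 1)
              (((magnify2 (μ.map Prod.fst) (proj (shift k ω)).1
                    (Real.logb 2 (Φ.wordRho (prefixList ω k)) -
                      Real.logb 2 (Φ.wordLam (prefixList ω k)))).prod
                  (μx (proj (shift k ω)).1)).map
                (fun z : ℝ × ℝ =>
                  ((2:ℝ) ^ c * z.1, (2:ℝ) ^ c * (z.2 - (proj (shift k ω)).2))))))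
          atTop (𝓝 0) := by
  subst hμ
  have hP := hbern.1
  have hm := hproj.measurable
  obtain ⟨δ, hδ0, hδ⟩ := hsep.exists_gap
  set μ := μbar.map proj with hμ
  have : IsProbabilityMeasure μ := Measure.isProbabilityMeasure_map hm.aemeasurable
  have hκx := ae_eq_condKernel_of_measure_eq_lintegral hprob hdis
  set κ := μ.condKernel
  have hκ : (μ.map Prod.fst).compProd κ = μ := μ.disintegrate κ
  set ν := μ.map Prod.fst
  have : IsProbabilityMeasure ν := Measure.isProbabilityMeasure_map measurable_fst.aemeasurable
  obtain ⟨r, hr0, hrδ, hat⟩ :=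
    exists_radius_forall_rat_no_atom μ κ (lt_min hδ0 one_pos)
  have hrc : (2 : ℝ) ^ (-(-Real.logb 2 r)) = r := by
    rw [neg_neg, Real.rpow_logb two_pos (by norm_num) hr0]
  have hc : 0 < -Real.logb 2 r :=
    neg_pos.2 (Real.logb_neg one_lt_two hr0 (hrδ.trans_le (min_le_right _ _)))
  set c := -Real.logb 2 r
  refine ⟨c, hc, ?_⟩
  have hgood := ae_sceneDev_tendsto hκ hr0 hat
  rw [← hrc] at hgood
  have hgood' := hgood.and (ae_of_ae_map measurable_fst.aemeasurable hκx)
  have hshift : ∀ᵐ ω ∂μbar, ∀ k, _ := ae_all_iff.2 fun k =>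
    (hbern.measurePreserving_shift hp hp1 k).quasiMeasurePreserving.ae
      (ae_of_ae_map hm.aemeasurable hgood')
  have hbirk : ∀ᵐ ω ∂μbar, ∀ q i : ℕ, Odd q → ∃ N, ∀ n : ℕ, ∑ k ∈ Finset.range n,
      sceneSup ν κ Φ.ecc c q N (proj (shift k ω)) ≤ ENNReal.ofReal (1 / (i + 1)) * n := by
    refine ae_all_iff.2 fun q => ae_all_iff.2 fun i => ?_
    by_cases hq : Odd q
    · have := ae_exists_birkhoffSum_le (hbern.measurePreserving_shift hp hp1 1)
        (H := fun N ω => sceneSup ν κ Φ.ecc c q N (proj ω))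
        (fun N => (measurable_sceneSup ν κ).comp hm) (fun N ω => sceneSup_le_one _)
        ((ae_of_ae_map hm.aemeasurable hgood).mono fun ω h => tendsto_sceneSup (h.2.2 q hq))
        (a := 1 / (i + 1)) (by positivity)
      simp only [shift_iterate] at this
      filter_upwards [this] with ω h _ using h
    · exact ae_of_all _ fun ω h => absurd h hq
  filter_upwards [hshift, hbirk, Φ.tendsto_ecc hbern hp hp1 hLyap] with ω h1 h2 h3
  refine tendsto_cesaro_zero (fun k => (levyProkhorovEDist_le_max_measure_univ _ _).trans
    (max_le (magnify2_univ_le _ _ _) (renormTo_univ_le _ _))) fun ε hε => ?_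
  obtain ⟨i, hi⟩ := exists_nat_one_div_lt hε
  obtain ⟨m, hm3⟩ := exists_nat_gt (3 / ε)
  have hqε : 3 / ((2 * m + 1 : ℕ) : ℝ) ≤ ε := by
    rw [div_le_comm₀ (by positivity) hε]
    push_cast
    have : (0 : ℝ) ≤ m := m.cast_nonneg
    linarith
  obtain ⟨N, hN⟩ := h2 (2 * m + 1) i (odd_two_mul_add_one m)
  refine ⟨fun k => sceneSup ν κ Φ.ecc c (2 * m + 1) N (proj (shift k ω)), ?_, fun n =>
    (hN n).trans (by gcongr)⟩
  filter_upwards [hproj.eventually_mem_cylinder hsep hδ hr0 (hrδ.trans_le (min_le_left _ _)) h3,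
    h3.eventually_ge_atTop N] with k hk1 hk2
  rw [← hrc] at hk1
  obtain ⟨⟨g1, g2, -⟩, g3⟩ := h1 k
  rw [hproj.magnify2_eq_zoomed hbern hp ω k c hk1, g3, ← hμ]
  have e := renormTo_prod_eq_zoomed ν (κ (proj (shift k ω)).1) (proj (shift k ω))
    (Φ.ecc (prefixList ω k)) hc (g1 _ (by positivity))
  have hle := levyProkhorovEDist_zoomed_le (c := c) (ν := ν) (κ := κ) (q := 2 * m + 1)
    (Nat.succ_pos _) (proj (shift k ω)) (Φ.ecc (prefixList ω k)) (g1 _ (by positivity)) g2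
  rw [hκ, ← e] at hle
  refine hle.trans (add_le_add (ENNReal.ofReal_le_ofReal hqε) ?_)
  exact le_iSup₂_of_le (prefixList ω k) hk2 le_rfl
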